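/- arXiv:1209.3684 — 2 statements merged into one kernel-verified Lean document; each statement's English description precedes it below -/
import Mathlib

section
/- Let ψ be a smooth global finite-energy 1-equivariant wave map and fix 0 < λ < 1. Then limsup_{t→∞} E_{λt}^{t−A}(ψ⃗(t)) → 0 as A → ∞; more precisely, for every ε > 0 there exist A₀ > 0 and T₀ > 0 such that E_{λt}^{t−A}(ψ⃗(t)) ≤ ε whenever A ≥ A₀, t ≥ T₀ and A ≤ (1−λ)t. -/
open MeasureTheory Real Filter Set

noncomputable section

/-- The ground state harmonic map `Q(r) = 2 arctan r`. -/
def Q (r : ℝ) : ℝ := 2 * Real.arctan r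

/-- Time derivative `∂ₜψ(t,r)`. -/
def pT (ψ : ℝ → ℝ → ℝ) (t r : ℝ) : ℝ := deriv (fun s => ψ s r) t

/-- Radial derivative `∂ᵣψ(t,r)`. -/
def pR (ψ : ℝ → ℝ → ℝ) (t r : ℝ) : ℝ := deriv (fun ρ => ψ t ρ) r

/-- Energy density `((∂ₜψ)² + (∂ᵣψ)² + sin²ψ/r²) · r`. -/
def eDen (ψ : ℝ → ℝ → ℝ) (t r : ℝ) : ℝ :=
  ((pT ψ t r) ^ 2 + (pR ψ t r) ^ 2 + (Real.sin (ψ t r)) ^ 2 / r ^ 2) * r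

/-- Localized energy `E_{r₁}^{r₂}(ψ⃗(t))`. -/
def locE (ψ : ℝ → ℝ → ℝ) (t r₁ r₂ : ℝ) : ℝ := ∫ r in Set.Ioc r₁ r₂, eDen ψ t r

/-- Total energy `E(ψ⃗(t))`. -/
def totE (ψ : ℝ → ℝ → ℝ) (t : ℝ) : ℝ := ∫ r in Set.Ioi (0:ℝ), eDen ψ t r

/-- `ψ` is a smooth global 1-equivariant wave map on `[0,∞) × (0,∞)`. -/
def IsWaveMap (ψ : ℝ → ℝ → ℝ) : Prop :=
  ContDiffOn ℝ (⊤ : ℕ∞) (fun p : ℝ × ℝ => ψ p.1 p.2) (Set.Ici (0:ℝ) ×ˢ Set.Ioi (0:ℝ)) ∧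
  ∀ t r : ℝ, 0 ≤ t → 0 < r →
    deriv (fun s => pT ψ s r) t - deriv (fun ρ => pR ψ t ρ) r
      - (1 / r) * pR ψ t r + Real.sin (2 * ψ t r) / (2 * r ^ 2) = 0

/-- Finite energy: the energy density is integrable at each time `t ≥ 0`. -/
def FiniteEnergy (ψ : ℝ → ℝ → ℝ) : Prop :=
  ∀ t : ℝ, 0 ≤ t → MeasureTheory.IntegrableOn (eDen ψ t) (Set.Ioi 0) volume

/-- The energy is conserved. -/
def EnergyConserved (ψ : ℝ → ℝ → ℝ) : Prop :=
  ∀ t : ℝ, 0 ≤ t → totE ψ t = totE ψ 0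

/-- Squared `H × L²` norm density `(ψ₁² + (∂ᵣψ₀)² + ψ₀²/r²) · r`. -/
def hl2Den (f g : ℝ → ℝ) (r : ℝ) : ℝ :=
  ((g r) ^ 2 + (deriv f r) ^ 2 + (f r) ^ 2 / r ^ 2) * r

/-- Squared `H × L²` norm of the pair `(f, g)` over the set of radii `S`. -/
def hl2Sq (f g : ℝ → ℝ) (S : Set ℝ) : ℝ := ∫ r in S, hl2Den f g r

/-- Squared `H` norm of `f` over the set of radii `S`. -/
def hSq (f : ℝ → ℝ) (S : Set ℝ) : ℝ :=
  ∫ r in S, ((deriv f r) ^ 2 + (f r) ^ 2 / r ^ 2) * r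

/-- Squared (radial) `L²` norm. -/
def l2Sq (g : ℝ → ℝ) : ℝ := ∫ r in Set.Ioi (0:ℝ), (g r) ^ 2 * r

/-- Wave map energy of a pair of data `(f, g)`. -/
def pairE (f g : ℝ → ℝ) : ℝ :=
  ∫ r in Set.Ioi (0:ℝ), ((g r) ^ 2 + (deriv f r) ^ 2 + (Real.sin (f r)) ^ 2 / r ^ 2) * r

/-- `φ` is a smooth solution of the linearized equation
`φ_tt − φ_rr − (1/r) φ_r + φ/r² = 0` on `ℝ × (0,∞)`. -/
def IsLinearWave (φ : ℝ → ℝ → ℝ) : Prop :=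
  ContDiffOn ℝ (⊤ : ℕ∞) (fun p : ℝ × ℝ => φ p.1 p.2) (Set.univ ×ˢ Set.Ioi (0:ℝ)) ∧
  ∀ t r : ℝ, 0 < r →
    deriv (fun s => pT φ s r) t - deriv (fun ρ => pR φ t ρ) r
      - (1 / r) * pR φ t r + φ t r / r ^ 2 = 0

/-- A linear wave has finite energy: its `H × L²` density is integrable at each time. -/
def LinFiniteEnergy (φ : ℝ → ℝ → ℝ) : Prop :=
  ∀ t : ℝ, MeasureTheory.IntegrableOn (hl2Den (φ t) (pT φ t)) (Set.Ioi 0) volume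

/-- Degree one boundary conditions: `ψ(t,0⁺) = 0`, `ψ(t,∞) = π`. -/
def DegreeOneBC (ψ : ℝ → ℝ → ℝ) : Prop :=
  ∀ t : ℝ, 0 ≤ t →
    Filter.Tendsto (ψ t) (nhdsWithin 0 (Set.Ioi 0)) (nhds 0) ∧
    Filter.Tendsto (ψ t) Filter.atTop (nhds Real.pi)

/-- Degree zero boundary conditions: `φ(t,0⁺) = 0`, `φ(t,∞) = 0`. -/
def DegreeZeroBC (φ : ℝ → ℝ → ℝ) : Prop :=
  ∀ t : ℝ, 0 ≤ t →
    Filter.Tendsto (φ t) (nhdsWithin 0 (Set.Ioi 0)) (nhds 0) ∧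
    Filter.Tendsto (φ t) Filter.atTop (nhds 0)

/-- `P` is a potential in null coordinates `0 < u < v` with `∂ᵥP = a ≥ 0` and `∂ᵤP = -b ≤ 0`, where
`b` satisfies `(∂ᵥb)² ≤ 24 a b / (v - u)²`. -/
structure IsNullPotential (P a b b' : ℝ → ℝ → ℝ) : Prop where
  hasDerivAt_right : ∀ u v, 0 < u → u < v → HasDerivAt (fun y => P u y) (a u v) v
  hasDerivAt_left : ∀ u v, 0 < u → u < v → HasDerivAt (fun x => P x v) (-b u v) u
  hasDerivAt_density : ∀ u v, 0 < u → u < v → HasDerivAt (fun y => b u y) (b' u v) v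
  right_nonneg : ∀ u v, 0 < u → u < v → 0 ≤ a u v
  left_nonneg : ∀ u v, 0 < u → u < v → 0 ≤ b u v
  sq_le : ∀ u v, 0 < u → u < v → b' u v ^ 2 ≤ 24 * (a u v * b u v) / (v - u) ^ 2

namespace IsNullPotential

variable {P a b b' : ℝ → ℝ → ℝ}

lemma mono_right (h : IsNullPotential P a b b') {u v w : ℝ} (hu : 0 < u) (huv : u < v)
    (hvw : v ≤ w) : P u v ≤ P u w := by
  refine monotoneOn_of_hasDerivWithinAt_nonneg (convex_Ici v) (f' := a u) ?_ ?_ ?_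
    self_mem_Ici hvw hvw
  · exact fun y hy =>
      (h.hasDerivAt_right u y hu (huv.trans_le hy)).continuousAt.continuousWithinAt
  · exact fun y hy => (h.hasDerivAt_right u y hu
      (huv.trans_le (interior_subset hy))).hasDerivWithinAt
  · exact fun y hy => h.right_nonneg u y hu (huv.trans_le (interior_subset hy))

lemma anti_left (h : IsNullPotential P a b b') {u w v : ℝ} (hu : 0 < u) (huw : u ≤ w)
    (hwv : w < v) : P w v ≤ P u v := by
  refine antitoneOn_of_hasDerivWithinAt_nonpos (convex_Icc u w) (f := fun x => P x v)
    (f' := fun x => -b x v) ?_ ?_ ?_ (left_mem_Icc.2 huw) (right_mem_Icc.2 huw) huw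
  · exact fun y hy => (h.hasDerivAt_left y v (hu.trans_le hy.1)
      (hy.2.trans_lt hwv)).continuousAt.continuousWithinAt
  · intro y hy
    have hy := interior_subset hy
    exact (h.hasDerivAt_left y v (hu.trans_le hy.1) (hy.2.trans_lt hwv)).hasDerivWithinAt
  · intro y hy
    have hy := interior_subset hy
    exact neg_nonpos.2 (h.left_nonneg y v (hu.trans_le hy.1) (hy.2.trans_lt hwv))

lemma neg_le_density_deriv (h : IsNullPotential P a b b') {u v s : ℝ} (hu : 0 < u) (huv : u < v)
    (hs : 0 < s) : -(a u v / (2 * s) + 12 * s / (v - u) ^ 2 * b u v) ≤ b' u v := by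
  have ha := h.right_nonneg u v hu huv
  have hb := h.left_nonneg u v hu huv
  have hvu : 0 < v - u := sub_pos.2 huv
  refine (abs_le_of_sq_le_sq' (?_ : b' u v ^ 2 ≤ _) (by positivity)).1
  refine (h.sq_le u v hu huv).trans ?_
  have key : 4 * ((a u v / (2 * s)) * (12 * s / (v - u) ^ 2 * b u v))
      = 24 * (a u v * b u v) / (v - u) ^ 2 := by
    field_simp
    ring
  rw [← key]
  nlinarith [sq_nonneg (a u v / (2 * s) - 12 * s / (v - u) ^ 2 * b u v)]

lemma density_le (h : IsNullPotential P a b b') {u v w s : ℝ} (hu : 0 < u) (huv : u < v)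
    (hvw : v ≤ w) (hs : 0 < s) :
    b u v ≤ exp (12 * s / (v - u)) * (b u w + (P u w - P u v) / (2 * s)) := by
  have hd : ∀ y, u < y → HasDerivAt
      (fun y => b u y * exp (-(12 * s / (y - u))) + P u y / (2 * s))
      (b' u y * exp (-(12 * s / (y - u)))
        + b u y * (exp (-(12 * s / (y - u))) * (12 * s / (y - u) ^ 2)) + a u y / (2 * s)) y := by
    intro y hy
    have hne : y - u ≠ 0 := (sub_pos.2 hy).ne'
    have h1 : HasDerivAt (fun y => -(12 * s / (y - u))) (12 * s / (y - u) ^ 2) y := by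
      convert! ((hasDerivAt_const y (12 * s)).div ((hasDerivAt_id y).sub_const u) hne).neg using 1
      simp [neg_div]
    exact ((h.hasDerivAt_density u y hu hy).mul h1.exp).add
      ((h.hasDerivAt_right u y hu hy).div_const _)
  have hmono := monotoneOn_of_hasDerivWithinAt_nonneg (convex_Ici v)
    (fun y hy => (hd y (huv.trans_le hy)).continuousAt.continuousWithinAt)
    (fun y hy => (hd y (huv.trans_le (interior_subset hy))).hasDerivWithinAt) (by
      intro y hy
      have hy : u < y := huv.trans_le (interior_subset hy)
      have h1 := h.neg_le_density_deriv hu hy hs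
      have ha := h.right_nonneg u y hu hy
      have hyu : 0 < y - u := sub_pos.2 hy
      have hE : exp (-(12 * s / (y - u))) ≤ 1 := exp_le_one_iff.2 (by
        rw [neg_nonpos]; positivity)
      have hE0 := exp_pos (-(12 * s / (y - u)))
      have ha' : 0 ≤ a u y / (2 * s) := by positivity
      nlinarith [mul_le_mul_of_nonneg_left h1 hE0.le, mul_nonneg ha' (sub_nonneg.2 hE)])
    self_mem_Ici hvw hvw
  have hE : exp (-(12 * s / (w - u))) ≤ 1 := exp_le_one_iff.2 (by
    have : 0 < w - u := sub_pos.2 (huv.trans_le hvw)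
    rw [neg_nonpos]; positivity)
  have hb := mul_le_of_le_one_right (h.left_nonneg u w hu (huv.trans_le hvw)) hE
  have h2 : b u v * exp (-(12 * s / (v - u))) ≤ b u w + (P u w - P u v) / (2 * s) := by
    rw [sub_div]
    linarith
  calc b u v = exp (12 * s / (v - u)) * (b u v * exp (-(12 * s / (v - u)))) := by
        rw [mul_comm (b u v), ← mul_assoc, ← exp_add]; simp
    _ ≤ _ := by gcongr

lemma gronwall (h : IsNullPotential P a b b') {α u v w κ : ℝ} (hα : 0 < α) (hαu : α ≤ u)
    (hκ : 0 < κ) (hu : u + κ * v ≤ v) (hvw : v ≤ w) (hv : 0 < v) :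
    P u w - P u v ≤ exp (exp (12 / κ)) *
      (P α w - P α v + exp (12 / κ) * (P α w - P u w)) := by
  set M := exp (12 / κ) with hM
  have hM1 : 1 ≤ M := one_le_exp (by positivity)
  have huv : u < v := by nlinarith [mul_pos hκ hv]
  set N : ℝ → ℝ := fun x => P x w - P x v + M * (P x w - P u w) with hN
  have hd : ∀ x ∈ Icc α u, HasDerivAt (fun x => N x * exp (-(M / (2 * v) * x)))
      ((-b x w - -b x v + M * (-b x w)) * exp (-(M / (2 * v) * x))
        + N x * (exp (-(M / (2 * v) * x)) * (-(M / (2 * v))))) x := by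
    intro x hx
    have hx0 := hα.trans_le hx.1
    have hxv := hx.2.trans_lt huv
    have h1 := h.hasDerivAt_left x w hx0 (hxv.trans_le hvw)
    have h2 := h.hasDerivAt_left x v hx0 hxv
    have h3 : HasDerivAt (fun x : ℝ => -(M / (2 * v) * x)) (-(M / (2 * v))) x := by
      convert! ((hasDerivAt_id x).const_mul (M / (2 * v))).neg using 1
      simp
    exact ((h1.sub h2).add ((h1.sub_const _).const_mul M)).mul h3.exp
  have hanti := antitoneOn_of_hasDerivWithinAt_nonpos (convex_Icc α u)
    (fun x hx => (hd x hx).continuousAt.continuousWithinAt)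
    (fun x hx => (hd x (interior_subset hx)).hasDerivWithinAt) (by
      intro x hx
      have hx := interior_subset hx
      have hx0 := hα.trans_le hx.1
      have hxv := hx.2.trans_lt huv
      have hq := h.mono_right hx0 hxv hvw
      have hu' := h.anti_left hx0 hx.2 (huv.trans_le hvw)
      have hbw := h.left_nonneg x w hx0 (hxv.trans_le hvw)
      have hle : 12 * v / (v - x) ≤ 12 / κ := by
        rw [div_le_div_iff₀ (sub_pos.2 hxv) hκ]
        nlinarith [hx.2]
      have hden : b x v ≤ M * (b x w + (P x w - P x v) / (2 * v)) := by
        refine (h.density_le hx0 hxv hvw hv).trans ?_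
        have : 0 ≤ (P x w - P x v) / (2 * v) := div_nonneg (sub_nonneg.2 hq) (by positivity)
        gcongr
        exact exp_le_exp.2 hle
      have hNx : M / (2 * v) * (P x w - P x v) ≤ M / (2 * v) * N x := by
        gcongr
        simp only [hN]
        have : 0 ≤ M * (P x w - P u w) := mul_nonneg (by positivity) (sub_nonneg.2 hu')
        linarith
      have heq : M * ((P x w - P x v) / (2 * v)) = M / (2 * v) * (P x w - P x v) := by ring
      have : -b x w - -b x v + M * (-b x w) - M / (2 * v) * N x ≤ 0 := by
        rw [mul_add] at hden
        linarith
      nlinarith [mul_nonneg (neg_nonneg.2 this) (exp_pos (-(M / (2 * v) * x))).le])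
    (left_mem_Icc.2 hαu) (right_mem_Icc.2 hαu) hαu
  have hNu : N u = P u w - P u v := by simp [hN]
  have hNα : 0 ≤ N α := by
    have h1 := h.mono_right hα (hαu.trans_lt huv) hvw
    have h2 := h.anti_left hα hαu (huv.trans_le hvw)
    exact add_nonneg (sub_nonneg.2 h1) (mul_nonneg (by positivity) (sub_nonneg.2 h2))
  calc P u w - P u v = exp (M / (2 * v) * u) * (N u * exp (-(M / (2 * v) * u))) := by
        rw [mul_comm (N u), ← mul_assoc, ← exp_add]; simp [hNu]
    _ ≤ exp (M / (2 * v) * u) * (N α * exp (-(M / (2 * v) * α))) := by gcongr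
    _ = exp (M / (2 * v) * u + -(M / (2 * v) * α)) * N α := by rw [exp_add]; ring
    _ ≤ exp M * N α := by
        gcongr
        have : M / (2 * v) * (u - α) ≤ M / (2 * v) * (2 * v) := by
          gcongr
          linarith
        rw [div_mul_cancel₀ _ (by positivity)] at this
        linarith

lemma exists_small (h : IsNullPotential P a b b') {C : ℝ}
    (hC : ∀ u v, 1 ≤ u → u < v → |P u v| ≤ C) {ε : ℝ} (hε : 0 < ε) :
    ∃ α β, 1 ≤ α ∧ α < β ∧ (∀ v w, β ≤ v → v ≤ w → P α w - P α v ≤ ε) ∧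
      ∀ u, α ≤ u → ∃ w₀, ∀ w, w₀ ≤ w → P α w - P u w ≤ ε := by
  set S : ℝ → ℝ := fun u => sSup (P u '' Ioi u) with hS
  have hbdd : ∀ u, 1 ≤ u → BddAbove (P u '' Ioi u) := by
    rintro u hu
    refine ⟨C, ?_⟩
    rintro _ ⟨v, hv, rfl⟩
    exact (abs_le.1 (hC u v hu hv)).2
  have hle : ∀ u v, 1 ≤ u → u < v → P u v ≤ S u := fun u v hu hv =>
    le_csSup (hbdd u hu) (mem_image_of_mem _ hv)
  have hne : ∀ u, (P u '' Ioi u).Nonempty := fun u => nonempty_Ioi.image _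
  have hSbdd : BddBelow (S '' Ici 1) := by
    refine ⟨-C, ?_⟩
    rintro _ ⟨u, hu, rfl⟩
    exact (abs_le.1 (hC u (u + 1) hu (by linarith))).1.trans (hle u _ hu (by linarith))
  obtain ⟨_, ⟨α, hα, rfl⟩, hα'⟩ := exists_lt_of_csInf_lt (nonempty_Ici.image S)
    (lt_add_of_pos_right (sInf (S '' Ici 1)) (half_pos hε))
  have hα : 1 ≤ α := hα
  obtain ⟨_, ⟨β, hβ, rfl⟩, hβ'⟩ := exists_lt_of_lt_csSup (hne α) (sub_lt_self (S α) hε)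
  have hβ : α < β := hβ
  refine ⟨α, β, hα, hβ, fun v w hv hw => ?_, fun u hu => ?_⟩
  · have h1 := h.mono_right (by linarith) hβ hv
    have h2 := hle α w hα (by linarith)
    linarith
  · have hu1 : 1 ≤ u := hα.trans hu
    obtain ⟨_, ⟨w₀, hw₀, rfl⟩, hw₀'⟩ :=
      exists_lt_of_lt_csSup (hne u) (sub_lt_self (S u) (half_pos hε))
    have hw₀ : u < w₀ := hw₀
    refine ⟨w₀, fun w hw => ?_⟩
    have h1 := h.mono_right (by linarith) hw₀ hw
    have h2 := hle α w hα (by linarith)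
    have h3 : sInf (S '' Ici 1) ≤ S u := csInf_le hSbdd (mem_image_of_mem _ hu1)
    linarith

theorem self_similar_decay (h : IsNullPotential P a b b') {C : ℝ}
    (hC : ∀ u v, 1 ≤ u → u < v → |P u v| ≤ C) {lam : ℝ} (hlam0 : 0 < lam) (hlam1 : lam < 1)
    {ε : ℝ} (hε : 0 < ε) :
    ∃ α > 0, ∃ T > 0, ∀ A t : ℝ, α ≤ A → T ≤ t → A ≤ (1 - lam) * t →
      P A (2 * t - A) - P ((1 - lam) * t) ((1 + lam) * t) ≤ ε := by
  set κ := lam / (1 + lam) with hκ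
  have hκ0 : 0 < κ := by positivity
  set M := exp (12 / κ) with hM
  set δ := ε / (exp M * (1 + M) + 1) with hδ
  have hδ0 : 0 < δ := by positivity
  obtain ⟨α, β, hα, hαβ, hβ, hlim⟩ := h.exists_small hC hδ0
  refine ⟨α, by linarith, β, by linarith, fun A t hA ht hAt => ?_⟩
  have ht0 : 0 < t := by linarith
  have hlt : 0 < lam * t := by positivity
  set u := (1 - lam) * t with hu
  set v := (1 + lam) * t with hv
  have hκv : κ * v = lam * t := by
    rw [hκ, hv]
    field_simp
  have huv : u + κ * v ≤ v := by
    rw [hκv, hu, hv]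
    linarith
  obtain ⟨w₀, hw₀⟩ := hlim u (hA.trans hAt)
  set w := max w₀ (2 * t) with hw
  have h2w : 2 * t ≤ w := le_max_right _ _
  have hvw : v ≤ w := by nlinarith
  have hlt' : A < 2 * t - A := by nlinarith
  have h1 := hw₀ w (le_max_left _ _)
  have h2 := hβ v w (by nlinarith) hvw
  have h3 := h.gronwall (by linarith) (hA.trans hAt) hκ0 huv hvw (by positivity)
  have h4 : P A (2 * t - A) ≤ P α w :=
    (h.mono_right (by linarith) hlt' (by linarith)).trans
      (h.anti_left (by linarith) hA (by linarith))
  have h5 : exp M * (P α w - P α v + M * (P α w - P u w)) ≤ exp M * (δ + M * δ) := by gcongr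
  have h6 : (exp M * (1 + M) + 1) * δ = ε := by
    rw [hδ, mul_div_cancel₀]
    positivity
  calc P A (2 * t - A) - P u v ≤ (P u w - P u v) + (P α w - P u w) := by linarith
    _ ≤ exp M * (δ + M * δ) + δ := add_le_add (h3.trans h5) h1
    _ = ε := by rw [← h6]; ring

end IsNullPotential

lemma ContinuousLinearMap.eq_smul_fst_add_smul_snd (L : ℝ × ℝ →L[ℝ] ℝ) :
    L = L (1, 0) • ContinuousLinearMap.fst ℝ ℝ ℝ + L (0, 1) • ContinuousLinearMap.snd ℝ ℝ ℝ := by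
  ext <;> simp

/-- The function `f` is differentiable at `p` with partial derivatives `f₁` and `f₂`. -/
def HasPartials (f : ℝ × ℝ → ℝ) (f₁ f₂ : ℝ) (p : ℝ × ℝ) : Prop :=
  HasFDerivAt f (f₁ • ContinuousLinearMap.fst ℝ ℝ ℝ + f₂ • ContinuousLinearMap.snd ℝ ℝ ℝ) p

lemma HasPartials.comp_line {f : ℝ × ℝ → ℝ} {f₁ f₂ x y x' y' s : ℝ} {γ₁ γ₂ : ℝ → ℝ}
    (h : HasPartials f f₁ f₂ (x, y)) (h₁ : HasDerivAt γ₁ x' s) (h₂ : HasDerivAt γ₂ y' s)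
    (hx : γ₁ s = x) (hy : γ₂ s = y) :
    HasDerivAt (fun s => f (γ₁ s, γ₂ s)) (f₁ * x' + f₂ * y') s := by
  subst hx hy
  have h : HasFDerivAt f (f₁ • ContinuousLinearMap.fst ℝ ℝ ℝ + f₂ • ContinuousLinearMap.snd ℝ ℝ ℝ)
    ((fun s => (γ₁ s, γ₂ s)) s) := h
  simpa [Function.comp_def] using h.comp_hasDerivAt s (h₁.prodMk h₂)

lemma HasPartials.fst {f : ℝ × ℝ → ℝ} {f₁ f₂ x y : ℝ} (h : HasPartials f f₁ f₂ (x, y)) :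
    HasDerivAt (fun s => f (s, y)) f₁ x := by
  simpa using h.comp_line (hasDerivAt_id x) (hasDerivAt_const x y) rfl rfl

lemma HasPartials.snd {f : ℝ × ℝ → ℝ} {f₁ f₂ x y : ℝ} (h : HasPartials f f₁ f₂ (x, y)) :
    HasDerivAt (fun s => f (x, s)) f₂ y := by
  simpa using h.comp_line (hasDerivAt_const y x) (hasDerivAt_id y) rfl rfl

lemma DifferentiableAt.hasPartials {f : ℝ × ℝ → ℝ} {p : ℝ × ℝ} (h : DifferentiableAt ℝ f p) :
    HasPartials f (fderiv ℝ f p (1, 0)) (fderiv ℝ f p (0, 1)) p := by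
  rw [HasPartials, ← ContinuousLinearMap.eq_smul_fst_add_smul_snd]
  exact h.hasFDerivAt

/-- The first-order form of the wave map equation at all points `(t, r)` with `t, r > 0`, where
`X = ∂ₜψ` and `Y = ∂ᵣψ`. -/
structure IsWaveMapJet (ψ : ℝ → ℝ → ℝ) (X Y Xt Z Yr : ℝ × ℝ → ℝ) : Prop where
  partials : ∀ p : ℝ × ℝ, 0 < p.1 → 0 < p.2 →
    HasPartials (fun p => ψ p.1 p.2) (X p) (Y p) p
  partials_time : ∀ p : ℝ × ℝ, 0 < p.1 → 0 < p.2 → HasPartials X (Xt p) (Z p) p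
  partials_radial : ∀ p : ℝ × ℝ, 0 < p.1 → 0 < p.2 → HasPartials Y (Z p) (Yr p) p
  equation : ∀ p : ℝ × ℝ, 0 < p.1 → 0 < p.2 →
    Xt p - Yr p - (1 / p.2) * Y p + sin (2 * ψ p.1 p.2) / (2 * p.2 ^ 2) = 0

lemma isOpen_quadrant : IsOpen {p : ℝ × ℝ | 0 < p.1 ∧ 0 < p.2} :=
  (isOpen_lt continuous_const continuous_fst).inter (isOpen_lt continuous_const continuous_snd)

lemma convex_quadrant : Convex ℝ {p : ℝ × ℝ | 0 < p.1 ∧ 0 < p.2} := by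
  have : {p : ℝ × ℝ | 0 < p.1 ∧ 0 < p.2} = Ioi 0 ×ˢ Ioi 0 := rfl
  rw [this]
  exact (convex_Ioi 0).prod (convex_Ioi 0)

lemma IsWaveMap.exists_jet {ψ : ℝ → ℝ → ℝ} (h : IsWaveMap ψ) :
    ∃ X Y Xt Z Yr, IsWaveMapJet ψ X Y Xt Z Yr := by
  set f : ℝ × ℝ → ℝ := fun p => ψ p.1 p.2 with hf
  set D : Set (ℝ × ℝ) := {p | 0 < p.1 ∧ 0 < p.2}
  have hsub : D ⊆ Ici 0 ×ˢ Ioi 0 := fun p hp => ⟨hp.1.le, hp.2⟩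
  have hfD : ∀ p ∈ D, ContDiffAt ℝ 2 f p := fun p hp =>
    ((h.1.mono hsub).contDiffAt (isOpen_quadrant.mem_nhds hp)).of_le
      (WithTop.coe_le_coe.2 (le_top : (2 : ℕ∞) ≤ ⊤))
  have hd : ∀ p ∈ D, DifferentiableAt ℝ f p := fun p hp =>
    (hfD p hp).differentiableAt (by simp)
  have hd2 : ∀ p ∈ D, DifferentiableAt ℝ (fderiv ℝ f) p := fun p hp =>
    ((hfD p hp).fderiv_right (m := 1) (by norm_num)).differentiableAt (by simp)
  set X : ℝ × ℝ → ℝ := fun p => fderiv ℝ f p (1, 0) with hX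
  set Y : ℝ × ℝ → ℝ := fun p => fderiv ℝ f p (0, 1) with hY
  have hXd : ∀ p ∈ D, DifferentiableAt ℝ X p := fun p hp =>
    (hd2 p hp).clm_apply (differentiableAt_const _)
  have hYd : ∀ p ∈ D, DifferentiableAt ℝ Y p := fun p hp =>
    (hd2 p hp).clm_apply (differentiableAt_const _)
  have hsymm : ∀ p ∈ D, fderiv ℝ Y p (1, 0) = fderiv ℝ X p (0, 1) := by
    intro p hp
    have hs := (hfD p hp).isSymmSndFDerivAt (by simp)
    rw [hX, hY, fderiv_clm_apply (hd2 p hp) (differentiableAt_const _),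
      fderiv_clm_apply (hd2 p hp) (differentiableAt_const _)]
    simpa using hs (1, 0) (0, 1)
  have hpT : ∀ t r, 0 < t → 0 < r → pT ψ t r = X (t, r) := fun t r ht hr =>
    (HasPartials.fst (hd (t, r) ⟨ht, hr⟩).hasPartials).deriv
  have hpR : ∀ t r, 0 < t → 0 < r → pR ψ t r = Y (t, r) := fun t r ht hr =>
    (HasPartials.snd (hd (t, r) ⟨ht, hr⟩).hasPartials).deriv
  refine ⟨X, Y, fun p => fderiv ℝ X p (1, 0), fun p => fderiv ℝ X p (0, 1),
    fun p => fderiv ℝ Y p (0, 1), fun p h1 h2 => (hd p ⟨h1, h2⟩).hasPartials,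
    fun p h1 h2 => (hXd p ⟨h1, h2⟩).hasPartials, fun p h1 h2 => ?_, ?_⟩
  · rw [← hsymm p ⟨h1, h2⟩]
    exact (hYd p ⟨h1, h2⟩).hasPartials
  · rintro ⟨t, r⟩ ht hr
    have h1 : deriv (fun s => pT ψ s r) t = fderiv ℝ X (t, r) (1, 0) := by
      rw [← (HasPartials.fst (hXd (t, r) ⟨ht, hr⟩).hasPartials).deriv]
      apply Filter.EventuallyEq.deriv_eq
      filter_upwards [lt_mem_nhds ht] with s hs using hpT s r hs hr
    have h2 : deriv (fun ρ => pR ψ t ρ) r = fderiv ℝ Y (t, r) (0, 1) := by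
      rw [← (HasPartials.snd (hYd (t, r) ⟨ht, hr⟩).hasPartials).deriv]
      apply Filter.EventuallyEq.deriv_eq
      filter_upwards [lt_mem_nhds hr] with s hs using hpR t s ht hs
    have := h.2 t r (le_of_lt ht) hr
    rwa [h1, h2, hpR t r ht hr] at this

namespace IsWaveMapJet

variable {ψ : ℝ → ℝ → ℝ} {X Y Xt Z Yr : ℝ × ℝ → ℝ}

/-- The momentum density `2 r ∂ₜψ ∂ᵣψ` in terms of the first derivatives `X = ∂ₜψ`, `Y = ∂ᵣψ`. -/
def momentum (X Y : ℝ × ℝ → ℝ) (p : ℝ × ℝ) : ℝ := 2 * p.2 * (X p * Y p)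

/-- The energy density in terms of the first derivatives `X = ∂ₜψ`, `Y = ∂ᵣψ`. -/
def energy (ψ : ℝ → ℝ → ℝ) (X Y : ℝ × ℝ → ℝ) (p : ℝ × ℝ) : ℝ :=
  p.2 * (X p ^ 2 + Y p ^ 2) + sin (ψ p.1 p.2) ^ 2 * (p.2)⁻¹

lemma eDen_eq (h : IsWaveMapJet ψ X Y Xt Z Yr) {t r : ℝ} (ht : 0 < t) (hr : 0 < r) :
    eDen ψ t r = energy ψ X Y (t, r) := by
  have h1 : pT ψ t r = X (t, r) := (h.partials (t, r) ht hr).fst.deriv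
  have h2 : pR ψ t r = Y (t, r) := (h.partials (t, r) ht hr).snd.deriv
  rw [eDen, h1, h2, energy]
  field_simp

lemma momentum_hasPartials (h : IsWaveMapJet ψ X Y Xt Z Yr) {p : ℝ × ℝ} (h1 : 0 < p.1)
    (h2 : 0 < p.2) :
    HasPartials (momentum X Y) (2 * p.2 * (Xt p * Y p + X p * Z p))
      (2 * (X p * Y p) + 2 * p.2 * (Z p * Y p + X p * Yr p)) p := by
  have := ((hasFDerivAt_snd (𝕜 := ℝ) (p := p)).const_mul 2).mul
    (HasFDerivAt.mul (h.partials_time p h1 h2) (h.partials_radial p h1 h2))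
  refine HasFDerivAt.congr_fderiv this ?_
  ext <;> simp <;> ring

lemma energy_hasPartials (h : IsWaveMapJet ψ X Y Xt Z Yr) {p : ℝ × ℝ} (h1 : 0 < p.1)
    (h2 : 0 < p.2) :
    HasPartials (energy ψ X Y)
      (2 * (X p * Y p) + 2 * p.2 * (Z p * Y p + X p * Yr p))
      (2 * p.2 * (Xt p * Y p + X p * Z p) + (X p ^ 2 - Y p ^ 2 - (sin (ψ p.1 p.2) / p.2) ^ 2
        + 4 * (sin (ψ p.1 p.2) / p.2) * cos (ψ p.1 p.2) * Y p)) p := by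
  have hinv := (hasDerivAt_inv h2.ne').comp_hasFDerivAt p (hasFDerivAt_snd (𝕜 := ℝ) (p := p))
  have := ((hasFDerivAt_snd (𝕜 := ℝ) (p := p)).mul
    ((HasFDerivAt.pow (h.partials_time p h1 h2) 2).add
      (HasFDerivAt.pow (h.partials_radial p h1 h2) 2))).add
    (((HasFDerivAt.sin (h.partials p h1 h2)).pow 2).mul hinv)
  refine HasFDerivAt.congr_fderiv this ?_
  have heq : Xt p = Yr p + (1 / p.2) * Y p - sin (ψ p.1 p.2) * cos (ψ p.1 p.2) / p.2 ^ 2 := by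
    have := h.equation p h1 h2
    rw [sin_two_mul, mul_assoc, mul_div_mul_left _ _ two_ne_zero] at this
    linarith
  ext
  · simp [heq]
    field_simp
    ring
  · simp [heq]
    field_simp
    ring

lemma exists_potential (h : IsWaveMapJet ψ X Y Xt Z Yr) :
    ∃ F : ℝ × ℝ → ℝ, ∀ p : ℝ × ℝ, 0 < p.1 → 0 < p.2 →
      HasPartials F (momentum X Y p) (energy ψ X Y p) p := by
  set ω : ℝ × ℝ → ℝ × ℝ →L[ℝ] ℝ := fun p =>
    momentum X Y p • ContinuousLinearMap.fst ℝ ℝ ℝ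
      + energy ψ X Y p • ContinuousLinearMap.snd ℝ ℝ ℝ with hω
  have hd : ∀ p ∈ {p : ℝ × ℝ | 0 < p.1 ∧ 0 < p.2}, HasFDerivAt ω _ p := fun p hp =>
    (HasFDerivAt.smul_const (h.momentum_hasPartials hp.1 hp.2)
      (ContinuousLinearMap.fst ℝ ℝ ℝ)).add
      (HasFDerivAt.smul_const (h.energy_hasPartials hp.1 hp.2) (ContinuousLinearMap.snd ℝ ℝ ℝ))
  obtain ⟨F, hF⟩ := convex_quadrant.exists_forall_hasFDerivAt_of_fderiv_symmetric isOpen_quadrant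
    (fun p hp => (hd p hp).differentiableAt.differentiableWithinAt) (by
      intro p hp x y
      rw [(hd p hp).fderiv]
      simp
      ring)
  exact ⟨F, fun p h1 h2 => hF p ⟨h1, h2⟩⟩

lemma abs_momentum_le_energy (p : ℝ × ℝ) (h2 : 0 < p.2) :
    |momentum X Y p| ≤ energy ψ X Y p := by
  have h0 : 0 ≤ sin (ψ p.1 p.2) ^ 2 * (p.2)⁻¹ := by positivity
  rw [abs_le, momentum, energy]
  constructor <;>
    nlinarith [mul_nonneg h2.le (sq_nonneg (X p + Y p)), mul_nonneg h2.le (sq_nonneg (X p - Y p))]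

lemma sq_source_le (p : ℝ × ℝ) (h2 : 0 < p.2) :
    (X p ^ 2 - Y p ^ 2 - (sin (ψ p.1 p.2) / p.2) ^ 2
        + 4 * (sin (ψ p.1 p.2) / p.2) * cos (ψ p.1 p.2) * Y p) ^ 2
      ≤ 24 * (energy ψ X Y p ^ 2 - momentum X Y p ^ 2) / p.2 ^ 2 := by
  set s := sin (ψ p.1 p.2) / p.2 with hs
  set c := cos (ψ p.1 p.2)
  have hc : c ^ 2 ≤ 1 := cos_sq_le_one _
  have he : energy ψ X Y p = p.2 * (X p ^ 2 + Y p ^ 2 + s ^ 2) := by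
    rw [energy, hs]
    field_simp
  have heq : 24 * (energy ψ X Y p ^ 2 - momentum X Y p ^ 2) / p.2 ^ 2
      = 24 * ((X p ^ 2 - Y p ^ 2) ^ 2 + 2 * s ^ 2 * (X p ^ 2 + Y p ^ 2) + s ^ 4) := by
    rw [he, momentum]
    field_simp
    ring
  rw [heq]
  have h3 : (s * Y p) ^ 2 * c ^ 2 ≤ (s * Y p) ^ 2 := mul_le_of_le_one_right (sq_nonneg _) hc
  nlinarith [sq_nonneg (X p ^ 2 - Y p ^ 2 + s ^ 2), sq_nonneg (X p ^ 2 - Y p ^ 2 - 4 * s * c * Y p),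
    sq_nonneg (s ^ 2 + 4 * s * c * Y p), sq_nonneg (s * X p), sq_nonneg (X p ^ 2 - Y p ^ 2),
    sq_nonneg (s ^ 2), sq_nonneg (s * Y p)]

lemma isNullPotential (h : IsWaveMapJet ψ X Y Xt Z Yr) {F : ℝ × ℝ → ℝ}
    (hF : ∀ p : ℝ × ℝ, 0 < p.1 → 0 < p.2 →
      HasPartials F (momentum X Y p) (energy ψ X Y p) p) :
    IsNullPotential (fun u v => F ((u + v) / 2, (v - u) / 2))
      (fun u v => (energy ψ X Y ((u + v) / 2, (v - u) / 2)
        + momentum X Y ((u + v) / 2, (v - u) / 2)) / 2)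
      (fun u v => (energy ψ X Y ((u + v) / 2, (v - u) / 2)
        - momentum X Y ((u + v) / 2, (v - u) / 2)) / 2)
      (fun u v => (fun p : ℝ × ℝ => (X p ^ 2 - Y p ^ 2 - (sin (ψ p.1 p.2) / p.2) ^ 2
        + 4 * (sin (ψ p.1 p.2) / p.2) * cos (ψ p.1 p.2) * Y p) / 4)
          ((u + v) / 2, (v - u) / 2)) := by
  have ht : ∀ u v : ℝ, 0 < u → u < v → 0 < (u + v) / 2 := fun u v hu hv => by linarith
  have hr : ∀ u v : ℝ, u < v → 0 < (v - u) / 2 := fun u v hv => by linarith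
  have dt : ∀ u v : ℝ, HasDerivAt (fun y => (u + y) / 2) (1 / 2) v := fun u v =>
    ((hasDerivAt_id v).const_add u).div_const 2
  have dr : ∀ u v : ℝ, HasDerivAt (fun y => (y - u) / 2) (1 / 2) v := fun u v =>
    ((hasDerivAt_id v).sub_const u).div_const 2
  have dt' : ∀ u v : ℝ, HasDerivAt (fun x => (x + v) / 2) (1 / 2) u := fun u v =>
    ((hasDerivAt_id u).add_const v).div_const 2
  have dr' : ∀ u v : ℝ, HasDerivAt (fun x => (v - x) / 2) (-1 / 2) u := fun u v =>
    ((hasDerivAt_id u).const_sub v).div_const 2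
  constructor
  · intro u v hu hv
    convert (hF _ (ht u v hu hv) (hr u v hv)).comp_line (dt u v) (dr u v) rfl rfl using 1
    ring
  · intro u v hu hv
    convert (hF _ (ht u v hu hv) (hr u v hv)).comp_line (dt' u v) (dr' u v) rfl rfl using 1
    ring
  · intro u v hu hv
    convert! ((((h.energy_hasPartials (p := ((u + v) / 2, (v - u) / 2)) (ht u v hu hv)
      (hr u v hv)).comp_line (dt u v) (dr u v) rfl rfl).sub
      ((h.momentum_hasPartials (p := ((u + v) / 2, (v - u) / 2)) (ht u v hu hv)
      (hr u v hv)).comp_line (dt u v) (dr u v) rfl rfl)).div_const 2) using 1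
    ring
  · intro u v hu hv
    have := (abs_le.1 (abs_momentum_le_energy (ψ := ψ) (X := X) (Y := Y)
      ((u + v) / 2, (v - u) / 2) (hr u v hv))).1
    linarith
  · intro u v hu hv
    have := (abs_le.1 (abs_momentum_le_energy (ψ := ψ) (X := X) (Y := Y)
      ((u + v) / 2, (v - u) / 2) (hr u v hv))).2
    linarith
  · intro u v hu hv
    have hvu : 0 < v - u := sub_pos.2 hv
    have := sq_source_le (ψ := ψ) (X := X) (Y := Y) ((u + v) / 2, (v - u) / 2) (hr u v hv)
    simp only at this ⊢
    rw [div_pow]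
    refine (div_le_div_of_nonneg_right this (by positivity)).trans (le_of_eq ?_)
    field_simp
    ring

lemma eDen_nonneg (ψ : ℝ → ℝ → ℝ) (t : ℝ) {r : ℝ} (hr : 0 < r) : 0 ≤ eDen ψ t r := by
  unfold eDen
  positivity

lemma locE_eq_sub (h : IsWaveMapJet ψ X Y Xt Z Yr) (hfe : FiniteEnergy ψ) {F : ℝ × ℝ → ℝ}
    (hF : ∀ p : ℝ × ℝ, 0 < p.1 → 0 < p.2 →
      HasPartials F (momentum X Y p) (energy ψ X Y p) p)
    {t r₁ r₂ : ℝ} (ht : 0 < t) (hr : 0 < r₁) (hrr : r₁ ≤ r₂) :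
    locE ψ t r₁ r₂ = F (t, r₂) - F (t, r₁) := by
  rw [locE, ← intervalIntegral.integral_of_le hrr]
  refine intervalIntegral.integral_eq_sub_of_hasDerivAt (f := fun r => F (t, r)) ?_ ?_
  · intro r hr'
    rw [uIcc_of_le hrr] at hr'
    have hr0 := hr.trans_le hr'.1
    rw [h.eDen_eq ht hr0]
    exact (hF (t, r) ht hr0).snd
  · rw [intervalIntegrable_iff_integrableOn_Ioc_of_le hrr]
    exact (hfe t ht.le).mono_set fun r hr' => hr.trans hr'.1

lemma sub_mem_Icc (h : IsWaveMapJet ψ X Y Xt Z Yr) (hfe : FiniteEnergy ψ)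
    (hcons : EnergyConserved ψ) {F : ℝ × ℝ → ℝ}
    (hF : ∀ p : ℝ × ℝ, 0 < p.1 → 0 < p.2 →
      HasPartials F (momentum X Y p) (energy ψ X Y p) p)
    {t r₁ r₂ : ℝ} (ht : 0 < t) (hr : 0 < r₁) (hrr : r₁ ≤ r₂) :
    F (t, r₂) - F (t, r₁) ∈ Icc 0 (totE ψ 0) := by
  rw [← h.locE_eq_sub hfe hF ht hr hrr, ← hcons t ht.le]
  refine ⟨setIntegral_nonneg measurableSet_Ioc fun r hr' => eDen_nonneg ψ t (hr.trans hr'.1),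
    setIntegral_mono_set (hfe t ht.le) ?_ ?_⟩
  · exact (ae_restrict_iff' measurableSet_Ioi).2 (.of_forall fun r hr' => eDen_nonneg ψ t hr')
  · exact (show Ioc r₁ r₂ ⊆ Ioi 0 from fun r hr' => hr.trans hr'.1).eventuallyLE

lemma potential_bounded (h : IsWaveMapJet ψ X Y Xt Z Yr) (hfe : FiniteEnergy ψ)
    (hcons : EnergyConserved ψ) {F : ℝ × ℝ → ℝ}
    (hF : ∀ p : ℝ × ℝ, 0 < p.1 → 0 < p.2 →
      HasPartials F (momentum X Y p) (energy ψ X Y p) p)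
    {t r : ℝ} (ht : 1 ≤ t) (hr : 0 < r) :
    |F (t, r) - F (1, 1)| ≤ totE ψ 0 := by
  have ht0 : 0 < t := by linarith
  have hin : F (t, r) ≤ F (1, r + t - 1) := by
    have hd : ∀ s ∈ Icc 1 t, HasDerivAt (fun s => F (s, r + t - s)) _ s := fun s hs =>
      (hF (s, r + t - s) (by linarith [hs.1]) (by linarith [hs.2])).comp_line (hasDerivAt_id s)
        ((hasDerivAt_id s).const_sub (r + t)) rfl rfl
    have := antitoneOn_of_hasDerivWithinAt_nonpos (convex_Icc 1 t)
      (fun s hs => (hd s hs).continuousAt.continuousWithinAt)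
      (fun s hs => (hd s (interior_subset hs)).hasDerivWithinAt) (by
        intro s hs
        have hs := interior_subset hs
        have := (abs_le.1 (abs_momentum_le_energy (ψ := ψ) (X := X) (Y := Y)
          (s, r + t - s) (by linarith [hs.2]))).2
        linarith) (left_mem_Icc.2 ht) (right_mem_Icc.2 ht) ht
    simpa using this
  have hout : F (1, r + 1) ≤ F (t, r + t) := by
    have hd : ∀ s ∈ Icc 1 t, HasDerivAt (fun s => F (s, r + s)) _ s := fun s hs =>
      (hF (s, r + s) (by linarith [hs.1]) (by linarith [hs.1])).comp_line (hasDerivAt_id s)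
        ((hasDerivAt_id s).const_add r) rfl rfl
    exact monotoneOn_of_hasDerivWithinAt_nonneg (convex_Icc 1 t)
      (fun s hs => (hd s hs).continuousAt.continuousWithinAt)
      (fun s hs => (hd s (interior_subset hs)).hasDerivWithinAt) (by
        intro s hs
        have hs := interior_subset hs
        have := (abs_le.1 (abs_momentum_le_energy (ψ := ψ) (X := X) (Y := Y)
          (s, r + s) (by linarith [hs.1]))).1
        linarith) (left_mem_Icc.2 ht) (right_mem_Icc.2 ht) ht
  have h1 := h.sub_mem_Icc hfe hcons hF one_pos (r₁ := r + t - 1) (by linarith)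
    (le_max_left _ 1)
  have h2 := h.sub_mem_Icc hfe hcons hF one_pos one_pos (le_max_right (r + t - 1) 1)
  have h3 := h.sub_mem_Icc hfe hcons hF one_pos (r₁ := 1) (r₂ := r + 1) one_pos (by linarith)
  have h4 := h.sub_mem_Icc hfe hcons hF ht0 hr (r₂ := r + t) (by linarith)
  rw [abs_le]
  constructor
  · linarith [h3.1, h4.2]
  · linarith [h1.1, h2.2]

end IsWaveMapJet

/-- decay of the energy in the self-similar region `λt ≤ r ≤ t − A`. -/
theorem stmt1_self_similar_energy_decay
    (ψ : ℝ → ℝ → ℝ) (lam : ℝ)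
    (hwm : IsWaveMap ψ) (hfe : FiniteEnergy ψ) (hcons : EnergyConserved ψ)
    (hlam0 : 0 < lam) (hlam1 : lam < 1) :
    ∀ ε > 0, ∃ A₀ > 0, ∃ T₀ > 0, ∀ A t : ℝ,
      A₀ ≤ A → T₀ ≤ t → A ≤ (1 - lam) * t →
      locE ψ t (lam * t) (t - A) ≤ ε := by
  intro ε hε
  obtain ⟨X, Y, Xt, Z, Yr, h⟩ := hwm.exists_jet
  obtain ⟨F, hF⟩ := h.exists_potential
  obtain ⟨A₀, hA₀, T₀, hT₀, hdecay⟩ := (h.isNullPotential hF).self_similar_decay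
    (C := totE ψ 0 + |F (1, 1)|) (fun u v hu hv => by
      have h1 := h.potential_bounded hfe hcons hF (t := (u + v) / 2) (r := (v - u) / 2)
        (by linarith) (by linarith)
      have h2 := abs_add_le (F ((u + v) / 2, (v - u) / 2) - F (1, 1)) (F (1, 1))
      rw [sub_add_cancel] at h2
      linarith) hlam0 hlam1 hε
  refine ⟨A₀, hA₀, T₀, hT₀, fun A t hA ht hAt => ?_⟩
  have ht0 : 0 < t := hT₀.trans_le ht
  rw [h.locE_eq_sub hfe hF ht0 (by positivity) (by linarith)]
  have := hdecay A t hA ht hAt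
  convert this using 4 <;> ring
end
end

section
/- Let ψ be a smooth global finite-energy 1-equivariant wave map. Then limsup_{T→∞} (1/T) ∫_A^T ∫₀^{t−A} (∂_tψ)²(t,r) r dr dt → 0 as A → ∞. -/
open MeasureTheory Real Filter Set

noncomputable section

/-- The triangle `x₀ ≤ x`, `x + c ≤ y ≤ y₁`. -/
def triangle (x₀ y₁ c : ℝ) : Set (ℝ × ℝ) := {z | x₀ ≤ z.1 ∧ z.1 + c ≤ z.2 ∧ z.2 ≤ y₁}

lemma isClosed_triangle (x₀ y₁ c : ℝ) : IsClosed (triangle x₀ y₁ c) :=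
  (isClosed_le continuous_const continuous_fst).inter
    ((isClosed_le (continuous_fst.add continuous_const) continuous_snd).inter
      (isClosed_le continuous_snd continuous_const))

lemma isCompact_triangle (x₀ y₁ c : ℝ) : IsCompact (triangle x₀ y₁ c) := by
  refine (isCompact_Icc (a := x₀) (b := y₁ - c)).prod (isCompact_Icc (a := x₀ + c) (b := y₁))
    |>.of_isClosed_subset (isClosed_triangle x₀ y₁ c) ?_
  rintro ⟨x, y⟩ ⟨h₁, h₂, h₃⟩
  simp only [mem_prod, mem_Icc] at *
  refine ⟨⟨?_, ?_⟩, ?_, ?_⟩ <;> linarith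

lemma integrable_triangle {k : ℝ → ℝ → ℝ} {x₀ y₁ c : ℝ}
    (hk : ContinuousOn (Function.uncurry k) (triangle x₀ y₁ c)) :
    Integrable ((triangle x₀ y₁ c).indicator (Function.uncurry k)) (volume.prod volume) := by
  rw [integrable_indicator_iff (isClosed_triangle x₀ y₁ c).measurableSet]
  exact hk.integrableOn_compact (μ := volume) (isCompact_triangle x₀ y₁ c)

lemma integral_triangle_snd (k : ℝ → ℝ → ℝ) (x₀ y₁ c x : ℝ) :
    ∫ y, (triangle x₀ y₁ c).indicator (Function.uncurry k) (x, y)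
      = (Icc x₀ (y₁ - c)).indicator (fun x => ∫ y in (x + c)..y₁, k x y) x := by
  by_cases hx : x ∈ Icc x₀ (y₁ - c)
  · have h : x + c ≤ y₁ := by linarith [hx.2]
    rw [indicator_of_mem hx, intervalIntegral.integral_of_le h, ← integral_Icc_eq_integral_Ioc,
      ← integral_indicator measurableSet_Icc]
    congr 1 with y
    by_cases hy : y ∈ Icc (x + c) y₁
    · rw [indicator_of_mem hy, indicator_of_mem (show (x, y) ∈ triangle x₀ y₁ c from
        ⟨hx.1, hy.1, hy.2⟩)]
      rfl
    · rw [indicator_of_notMem hy, indicator_of_notMem fun h' => hy ⟨h'.2.1, h'.2.2⟩]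
  · rw [indicator_of_notMem hx]
    refine (integral_congr_ae (Eventually.of_forall fun y => ?_)).trans (integral_zero ℝ ℝ)
    refine indicator_of_notMem (fun h => hx ⟨h.1, ?_⟩) _
    have h₁ := h.2.1
    have h₂ := h.2.2
    simp only at h₁ h₂
    linarith

lemma integral_triangle_fst (k : ℝ → ℝ → ℝ) (x₀ y₁ c y : ℝ) :
    ∫ x, (triangle x₀ y₁ c).indicator (Function.uncurry k) (x, y)
      = (Icc (x₀ + c) y₁).indicator (fun y => ∫ x in x₀..(y - c), k x y) y := by
  by_cases hy : y ∈ Icc (x₀ + c) y₁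
  · have h : x₀ ≤ y - c := by linarith [hy.1]
    rw [indicator_of_mem hy, intervalIntegral.integral_of_le h, ← integral_Icc_eq_integral_Ioc,
      ← integral_indicator measurableSet_Icc]
    congr 1 with x
    by_cases hx : x ∈ Icc x₀ (y - c)
    · rw [indicator_of_mem hx, indicator_of_mem (show (x, y) ∈ triangle x₀ y₁ c from
        ⟨hx.1, by simp only; linarith [hx.2], hy.2⟩)]
      rfl
    · rw [indicator_of_notMem hx, indicator_of_notMem fun h' => hx ⟨h'.1, by
        have := h'.2.1
        simp only at this
        linarith⟩]
  · rw [indicator_of_notMem hy]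
    refine (integral_congr_ae (Eventually.of_forall fun x => ?_)).trans (integral_zero ℝ ℝ)
    refine indicator_of_notMem (fun h => hy ⟨?_, h.2.2⟩) _
    have h₁ := h.1
    have h₂ := h.2.1
    simp only at h₁ h₂
    linarith

lemma intervalIntegrable_triangle {k : ℝ → ℝ → ℝ} {x₀ y₁ c : ℝ} (h : x₀ + c ≤ y₁)
    (hk : ContinuousOn (Function.uncurry k) (triangle x₀ y₁ c)) :
    IntervalIntegrable (fun x => ∫ y in (x + c)..y₁, k x y) volume x₀ (y₁ - c) := by
  have h₁ := (integrable_triangle hk).integral_prod_left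
  simp_rw [integral_triangle_snd] at h₁
  rw [intervalIntegrable_iff_integrableOn_Icc_of_le (by linarith),
    ← integrable_indicator_iff measurableSet_Icc]
  exact h₁

/-- Fubini's theorem on a triangle. -/
lemma integral_triangle_swap {k : ℝ → ℝ → ℝ} {x₀ y₁ c : ℝ} (h : x₀ + c ≤ y₁)
    (hk : ContinuousOn (Function.uncurry k) (triangle x₀ y₁ c)) :
    ∫ x in x₀..(y₁ - c), ∫ y in (x + c)..y₁, k x y
      = ∫ y in (x₀ + c)..y₁, ∫ x in x₀..(y - c), k x y := by
  have h₁ := integral_integral_swap (f := fun x y =>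
    (triangle x₀ y₁ c).indicator (Function.uncurry k) (x, y)) (integrable_triangle hk)
  simp_rw [integral_triangle_snd, integral_triangle_fst] at h₁
  rwa [integral_indicator measurableSet_Icc, integral_indicator measurableSet_Icc,
    integral_Icc_eq_integral_Ioc, integral_Icc_eq_integral_Ioc,
    ← intervalIntegral.integral_of_le (by linarith), ← intervalIntegral.integral_of_le h] at h₁

lemma continuousOn_section_snd {k : ℝ → ℝ → ℝ} {D : Set (ℝ × ℝ)}
    (hk : ContinuousOn (Function.uncurry k) D) {x a b : ℝ} (hab : a ≤ b)
    (hD : ∀ y ∈ Icc a b, (x, y) ∈ D) : ContinuousOn (fun y => k x y) (uIcc a b) := by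
  rw [uIcc_of_le hab]
  exact hk.comp (f := fun y => (x, y)) (by fun_prop) hD

lemma continuousOn_section_fst {k : ℝ → ℝ → ℝ} {D : Set (ℝ × ℝ)}
    (hk : ContinuousOn (Function.uncurry k) D) {y a b : ℝ} (hab : a ≤ b)
    (hD : ∀ x ∈ Icc a b, (x, y) ∈ D) : ContinuousOn (fun x => k x y) (uIcc a b) := by
  rw [uIcc_of_le hab]
  exact hk.comp (f := fun x => (x, y)) (by fun_prop) hD

/-- The divergence theorem on a triangle. -/
lemma triangle_divergence {u v u' v' : ℝ → ℝ → ℝ} {x₀ y₁ c : ℝ} (h : x₀ + c ≤ y₁)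
    (hu : ∀ x y, (x, y) ∈ triangle x₀ y₁ c → HasDerivAt (fun x => u x y) (u' x y) x)
    (hv : ∀ x y, (x, y) ∈ triangle x₀ y₁ c → HasDerivAt (fun y => v x y) (v' x y) y)
    (hu' : ContinuousOn (Function.uncurry u') (triangle x₀ y₁ c))
    (hv' : ContinuousOn (Function.uncurry v') (triangle x₀ y₁ c)) :
    ∫ x in x₀..(y₁ - c), ∫ y in (x + c)..y₁, (v' x y - u' x y)
      = (∫ x in x₀..(y₁ - c), (v x y₁ - v x (x + c)))
        + ∫ y in (x₀ + c)..y₁, (u x₀ y - u (y - c) y) := by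
  have hsnd : ∀ x ∈ uIcc x₀ (y₁ - c), x + c ≤ y₁ ∧
      ∀ y ∈ Icc (x + c) y₁, (x, y) ∈ triangle x₀ y₁ c := by
    intro x hx
    rw [uIcc_of_le (by linarith)] at hx
    exact ⟨by linarith [hx.2], fun y hy => ⟨hx.1, hy.1, hy.2⟩⟩
  have hfst : ∀ y ∈ uIcc (x₀ + c) y₁, x₀ ≤ y - c ∧
      ∀ x ∈ Icc x₀ (y - c), (x, y) ∈ triangle x₀ y₁ c := by
    intro y hy
    rw [uIcc_of_le h] at hy
    exact ⟨by linarith [hy.1], fun x hx => ⟨hx.1, by simp only; linarith [hx.2], hy.2⟩⟩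
  have e₁ : ∫ x in x₀..(y₁ - c), ∫ y in (x + c)..y₁, (v' x y - u' x y)
      = ∫ x in x₀..(y₁ - c), ((∫ y in (x + c)..y₁, v' x y) - ∫ y in (x + c)..y₁, u' x y) := by
    refine intervalIntegral.integral_congr fun x hx => ?_
    obtain ⟨h₁, h₂⟩ := hsnd x hx
    exact intervalIntegral.integral_sub
      (continuousOn_section_snd hv' h₁ h₂).intervalIntegrable
      (continuousOn_section_snd hu' h₁ h₂).intervalIntegrable
  rw [e₁, intervalIntegral.integral_sub (intervalIntegrable_triangle h hv')
    (intervalIntegrable_triangle h hu'), integral_triangle_swap h hu', sub_eq_add_neg,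
    ← intervalIntegral.integral_neg]
  congr 1
  · refine intervalIntegral.integral_congr fun x hx => ?_
    obtain ⟨h₁, h₂⟩ := hsnd x hx
    refine intervalIntegral.integral_eq_sub_of_hasDerivAt (fun y hy => hv x y (h₂ y ?_))
      (continuousOn_section_snd hv' h₁ h₂).intervalIntegrable
    rwa [uIcc_of_le h₁] at hy
  · refine intervalIntegral.integral_congr fun y hy => ?_
    obtain ⟨h₁, h₂⟩ := hfst y hy
    rw [intervalIntegral.integral_eq_sub_of_hasDerivAt (f := fun x => u x y)
      (fun x hx => hu x y (h₂ x (by rwa [uIcc_of_le h₁] at hx)))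
      (continuousOn_section_fst hu' h₁ h₂).intervalIntegrable]
    ring

lemma integrable_rectangle {k : ℝ → ℝ → ℝ} {x₀ x₁ y₀ y₁ : ℝ}
    (hk : ContinuousOn (Function.uncurry k) (Icc x₀ x₁ ×ˢ Icc y₀ y₁)) :
    Integrable (Function.uncurry k)
      ((volume.restrict (Icc x₀ x₁)).prod (volume.restrict (Icc y₀ y₁))) := by
  rw [Measure.prod_restrict]
  exact hk.integrableOn_compact (μ := volume) (isCompact_Icc.prod isCompact_Icc)

/-- Fubini's theorem on a rectangle. -/
lemma integral_rectangle_swap {k : ℝ → ℝ → ℝ} {x₀ x₁ y₀ y₁ : ℝ} (hx : x₀ ≤ x₁) (hy : y₀ ≤ y₁)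
    (hk : ContinuousOn (Function.uncurry k) (Icc x₀ x₁ ×ˢ Icc y₀ y₁)) :
    ∫ x in x₀..x₁, ∫ y in y₀..y₁, k x y = ∫ y in y₀..y₁, ∫ x in x₀..x₁, k x y := by
  simp_rw [intervalIntegral.integral_of_le hx, intervalIntegral.integral_of_le hy,
    ← integral_Icc_eq_integral_Ioc]
  exact integral_integral_swap (integrable_rectangle hk)

/-- The divergence theorem on a rectangle, as an inequality. -/
lemma rectangle_divergence_le {u v u' v' : ℝ → ℝ → ℝ} {x₀ x₁ y₀ y₁ : ℝ}
    (hx : x₀ ≤ x₁) (hy : y₀ ≤ y₁)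
    (hu : ∀ x ∈ Icc x₀ x₁, ∀ y ∈ Icc y₀ y₁, HasDerivAt (fun x => u x y) (u' x y) x)
    (hv : ∀ x ∈ Icc x₀ x₁, ∀ y ∈ Icc y₀ y₁, HasDerivAt (fun y => v x y) (v' x y) y)
    (hu' : ContinuousOn (Function.uncurry u') (Icc x₀ x₁ ×ˢ Icc y₀ y₁))
    (hv' : ContinuousOn (Function.uncurry v') (Icc x₀ x₁ ×ˢ Icc y₀ y₁))
    (hle : ∀ x ∈ Icc x₀ x₁, ∀ y ∈ Icc y₀ y₁, u' x y ≤ v' x y) :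
    ∫ y in y₀..y₁, (u x₁ y - u x₀ y) ≤ ∫ x in x₀..x₁, (v x y₁ - v x y₀) := by
  have e₁ : ∫ y in y₀..y₁, (u x₁ y - u x₀ y) = ∫ y in y₀..y₁, ∫ x in x₀..x₁, u' x y := by
    refine intervalIntegral.integral_congr fun y hy' => ?_
    rw [uIcc_of_le hy] at hy'
    refine (intervalIntegral.integral_eq_sub_of_hasDerivAt (f := fun x => u x y)
      (fun x hx' => hu x (by rwa [uIcc_of_le hx] at hx') y hy')
      (continuousOn_section_fst hu' hx fun x hx' => ⟨hx', hy'⟩).intervalIntegrable).symm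
  have e₂ : ∫ x in x₀..x₁, (v x y₁ - v x y₀) = ∫ x in x₀..x₁, ∫ y in y₀..y₁, v' x y := by
    refine intervalIntegral.integral_congr fun x hx' => ?_
    rw [uIcc_of_le hx] at hx'
    refine (intervalIntegral.integral_eq_sub_of_hasDerivAt (f := fun y => v x y)
      (fun y hy' => hv x hx' y (by rwa [uIcc_of_le hy] at hy'))
      (continuousOn_section_snd hv' hy fun y hy' => ⟨hx', hy'⟩).intervalIntegrable).symm
  have h_int : ∀ {k : ℝ → ℝ → ℝ},
      ContinuousOn (Function.uncurry k) (Icc x₀ x₁ ×ˢ Icc y₀ y₁) →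
      IntervalIntegrable (fun x => ∫ y in y₀..y₁, k x y) volume x₀ x₁ := by
    intro k hk
    rw [intervalIntegrable_iff_integrableOn_Icc_of_le hx]
    simp_rw [intervalIntegral.integral_of_le hy, ← integral_Icc_eq_integral_Ioc]
    exact (integrable_rectangle hk).integral_prod_left
  rw [e₁, e₂, ← integral_rectangle_swap hx hy hu']
  refine intervalIntegral.integral_mono_on hx (h_int hu') (h_int hv') fun x hx' => ?_
  exact intervalIntegral.integral_mono_on hy
    (continuousOn_section_snd hu' hy fun y hy' => ⟨hx', hy'⟩).intervalIntegrable
    (continuousOn_section_snd hv' hy fun y hy' => ⟨hx', hy'⟩).intervalIntegrable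
    fun y hy' => hle x hx' y hy'

/-- The half plane `t > 0`, `r > 0` in the null coordinates `(t - r, t + r)`. -/
def nullDomain : Set (ℝ × ℝ) := {z | 0 < z.1 + z.2 ∧ z.1 < z.2}

/-- `φ`, `p = φ_t + φ_r` and `m = φ_t - φ_r` for a wave map `φ`, in the null coordinates
`x = t - r`, `y = t + r`. -/
structure NullWave (φ p m : ℝ → ℝ → ℝ) : Prop where
  continuousOn : ContinuousOn (Function.uncurry φ) nullDomain
  continuousOn_out : ContinuousOn (Function.uncurry p) nullDomain
  continuousOn_in : ContinuousOn (Function.uncurry m) nullDomain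
  hasDerivAt_fst : ∀ x y, (x, y) ∈ nullDomain → HasDerivAt (fun x => φ x y) (m x y / 2) x
  hasDerivAt_snd : ∀ x y, (x, y) ∈ nullDomain → HasDerivAt (fun y => φ x y) (p x y / 2) y
  hasDerivAt_out : ∀ x y, (x, y) ∈ nullDomain → HasDerivAt (fun x => p x y)
    (((p x y - m x y) / (y - x) - 2 * sin (2 * φ x y) / (y - x) ^ 2) / 2) x
  hasDerivAt_in : ∀ x y, (x, y) ∈ nullDomain → HasDerivAt (fun y => m x y)
    (((p x y - m x y) / (y - x) - 2 * sin (2 * φ x y) / (y - x) ^ 2) / 2) y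

/-- The density of the energy flux through a null line; `q` is the derivative of `φ` along it. -/
def nullFlux (φ q : ℝ → ℝ → ℝ) (x y : ℝ) : ℝ :=
  (y - x) / 2 * q x y ^ 2 + 2 * sin (φ x y) ^ 2 / (y - x)

/-- The density of the flux of the radial momentum `r² φ_t φ_r` through a null line. -/
def momentumFlux (φ q : ℝ → ℝ → ℝ) (x y : ℝ) : ℝ :=
  (y - x) ^ 2 / 8 * q x y ^ 2 - sin (φ x y) ^ 2 / 2

/-- The rate of exchange between outgoing and incoming energy. -/
def fluxExchange (φ p m : ℝ → ℝ → ℝ) (x y : ℝ) : ℝ :=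
  -(p x y * m x y) / 2 - (p x y - m x y) * sin (2 * φ x y) / (y - x)
    + 2 * sin (φ x y) ^ 2 / (y - x) ^ 2

lemma nullFlux_nonneg {φ q : ℝ → ℝ → ℝ} {x y : ℝ} (h : x < y) : 0 ≤ nullFlux φ q x y := by
  have := sub_pos.2 h
  unfold nullFlux
  positivity

lemma continuousOn_nullFlux {φ q : ℝ → ℝ → ℝ}
    (hφ : ContinuousOn (Function.uncurry φ) nullDomain)
    (hq : ContinuousOn (Function.uncurry q) nullDomain) :
    ContinuousOn (Function.uncurry (nullFlux φ q)) nullDomain := by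
  have h : ∀ z ∈ nullDomain, z.2 - z.1 ≠ 0 := fun z hz => (sub_pos.2 hz.2).ne'
  change ContinuousOn (fun z : ℝ × ℝ => (z.2 - z.1) / 2 * (Function.uncurry q z) ^ 2
    + 2 * sin (Function.uncurry φ z) ^ 2 / (z.2 - z.1)) nullDomain
  fun_prop (disch := assumption)

lemma intervalIntegrable_of_mem_nullDomain {q : ℝ → ℝ → ℝ}
    (hq : ContinuousOn (Function.uncurry q) nullDomain) (f g : ℝ → ℝ) {a b : ℝ} (hab : a ≤ b)
    (hf : Continuous f) (hg : Continuous g) (h : ∀ x ∈ Icc a b, (f x, g x) ∈ nullDomain) :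
    IntervalIntegrable (fun x => q (f x) (g x)) volume a b := by
  refine ContinuousOn.intervalIntegrable ?_
  rw [uIcc_of_le hab]
  exact hq.comp (f := fun x => (f x, g x)) (by fun_prop) h

namespace NullWave

variable {φ p m : ℝ → ℝ → ℝ}

lemma hasDerivAt_outFlux (H : NullWave φ p m) {x y : ℝ} (hxy : (x, y) ∈ nullDomain) :
    HasDerivAt (fun x => nullFlux φ p x y) (fluxExchange φ p m x y) x := by
  have h : y - x ≠ 0 := (sub_pos.2 hxy.2).ne'
  have hr : HasDerivAt (fun x : ℝ => y - x) (-1) x := by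
    simpa using (hasDerivAt_id x).const_sub y
  have hs := (H.hasDerivAt_fst x y hxy).sin
  have hp := H.hasDerivAt_out x y hxy
  refine (((hr.div_const 2).mul (hp.pow 2)).add (((hs.pow 2).const_mul 2).div hr h)).congr_deriv ?_
  simp only [fluxExchange, Pi.pow_apply, sin_two_mul]
  field_simp
  ring

lemma hasDerivAt_inFlux (H : NullWave φ p m) {x y : ℝ} (hxy : (x, y) ∈ nullDomain) :
    HasDerivAt (fun y => nullFlux φ m x y) (-fluxExchange φ p m x y) y := by
  have h : y - x ≠ 0 := (sub_pos.2 hxy.2).ne'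
  have hr : HasDerivAt (fun y : ℝ => y - x) 1 y := (hasDerivAt_id y).sub_const x
  have hs := (H.hasDerivAt_snd x y hxy).sin
  have hp := H.hasDerivAt_in x y hxy
  refine (((hr.div_const 2).mul (hp.pow 2)).add (((hs.pow 2).const_mul 2).div hr h)).congr_deriv ?_
  simp only [fluxExchange, Pi.pow_apply, sin_two_mul]
  field_simp
  ring

/-- The `x`-derivative of the outgoing momentum flux. -/
def outMomentumDeriv (φ p m : ℝ → ℝ → ℝ) (x y : ℝ) : ℝ :=
  -((y - x) / 8 * (p x y ^ 2 + p x y * m x y)) - (p x y + m x y) * sin (2 * φ x y) / 4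

/-- The `y`-derivative of the incoming momentum flux. -/
def inMomentumDeriv (φ p m : ℝ → ℝ → ℝ) (x y : ℝ) : ℝ :=
  (y - x) / 8 * (m x y ^ 2 + p x y * m x y) - (p x y + m x y) * sin (2 * φ x y) / 4

lemma hasDerivAt_outMomentum (H : NullWave φ p m) {x y : ℝ} (hxy : (x, y) ∈ nullDomain) :
    HasDerivAt (fun x => momentumFlux φ p x y) (outMomentumDeriv φ p m x y) x := by
  have h : y - x ≠ 0 := (sub_pos.2 hxy.2).ne'
  have hr : HasDerivAt (fun x : ℝ => y - x) (-1) x := by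
    simpa using (hasDerivAt_id x).const_sub y
  have hs := (H.hasDerivAt_fst x y hxy).sin
  have hp := H.hasDerivAt_out x y hxy
  refine ((((hr.pow 2).div_const 8).mul (hp.pow 2)).sub ((hs.pow 2).div_const 2)).congr_deriv ?_
  simp only [outMomentumDeriv, Pi.pow_apply, sin_two_mul]
  field_simp
  ring

lemma hasDerivAt_inMomentum (H : NullWave φ p m) {x y : ℝ} (hxy : (x, y) ∈ nullDomain) :
    HasDerivAt (fun y => momentumFlux φ m x y) (inMomentumDeriv φ p m x y) y := by
  have h : y - x ≠ 0 := (sub_pos.2 hxy.2).ne'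
  have hr : HasDerivAt (fun y : ℝ => y - x) 1 y := (hasDerivAt_id y).sub_const x
  have hs := (H.hasDerivAt_snd x y hxy).sin
  have hp := H.hasDerivAt_in x y hxy
  refine ((((hr.pow 2).div_const 8).mul (hp.pow 2)).sub ((hs.pow 2).div_const 2)).congr_deriv ?_
  simp only [inMomentumDeriv, Pi.pow_apply, sin_two_mul]
  field_simp
  ring

lemma continuousOn_outFlux (H : NullWave φ p m) :
    ContinuousOn (Function.uncurry (nullFlux φ p)) nullDomain :=
  continuousOn_nullFlux H.continuousOn H.continuousOn_out

lemma continuousOn_inFlux (H : NullWave φ p m) :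
    ContinuousOn (Function.uncurry (nullFlux φ m)) nullDomain :=
  continuousOn_nullFlux H.continuousOn H.continuousOn_in

lemma continuousOn_fluxExchange (H : NullWave φ p m) :
    ContinuousOn (Function.uncurry (fluxExchange φ p m)) nullDomain := by
  have h : ∀ z ∈ nullDomain, z.2 - z.1 ≠ 0 := fun z hz => (sub_pos.2 hz.2).ne'
  have h' : ∀ z ∈ nullDomain, (z.2 - z.1) ^ 2 ≠ 0 := fun z hz => pow_ne_zero 2 (h z hz)
  have h₁ := H.continuousOn
  have h₂ := H.continuousOn_out
  have h₃ := H.continuousOn_in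
  change ContinuousOn (fun z : ℝ × ℝ => -(Function.uncurry p z * Function.uncurry m z) / 2
    - (Function.uncurry p z - Function.uncurry m z) * sin (2 * Function.uncurry φ z)
      / (z.2 - z.1) + 2 * sin (Function.uncurry φ z) ^ 2 / (z.2 - z.1) ^ 2) nullDomain
  fun_prop (disch := assumption)

lemma continuousOn_outMomentumDeriv (H : NullWave φ p m) :
    ContinuousOn (Function.uncurry (outMomentumDeriv φ p m)) nullDomain := by
  have h₁ := H.continuousOn
  have h₂ := H.continuousOn_out
  have h₃ := H.continuousOn_in
  change ContinuousOn (fun z : ℝ × ℝ => -((z.2 - z.1) / 8 * (Function.uncurry p z ^ 2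
    + Function.uncurry p z * Function.uncurry m z)) - (Function.uncurry p z
    + Function.uncurry m z) * sin (2 * Function.uncurry φ z) / 4) nullDomain
  fun_prop

lemma continuousOn_inMomentumDeriv (H : NullWave φ p m) :
    ContinuousOn (Function.uncurry (inMomentumDeriv φ p m)) nullDomain := by
  have h₁ := H.continuousOn
  have h₂ := H.continuousOn_out
  have h₃ := H.continuousOn_in
  change ContinuousOn (fun z : ℝ × ℝ => (z.2 - z.1) / 8 * (Function.uncurry m z ^ 2
    + Function.uncurry p z * Function.uncurry m z) - (Function.uncurry p z
    + Function.uncurry m z) * sin (2 * Function.uncurry φ z) / 4) nullDomain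
  fun_prop

/-- Energy identity on the triangle below the point `(x₁, y₁)` and above the slice `t = t₀`. -/
lemma past_triangle (H : NullWave φ p m) {x₁ y₁ t₀ : ℝ} (ht : 0 < t₀) (hx : x₁ < t₀)
    (hy : 2 * t₀ ≤ x₁ + y₁) :
    (∫ x in (2 * t₀ - y₁)..x₁, nullFlux φ m x y₁)
      + ∫ y in (2 * t₀ - x₁)..y₁, nullFlux φ p x₁ y
      = ∫ r in (t₀ - x₁)..(y₁ - t₀),
          (nullFlux φ p (t₀ - r) (t₀ + r) + nullFlux φ m (t₀ - r) (t₀ + r)) := by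
  have hmem : ∀ x y, (x, y) ∈ triangle (-x₁) y₁ (2 * t₀) → (-x, y) ∈ nullDomain := by
    rintro x y ⟨h₁, h₂, h₃⟩
    simp only at h₁ h₂ h₃
    constructor <;> simp only <;> linarith
  have hmaps : MapsTo (fun z : ℝ × ℝ => (-z.1, z.2)) (triangle (-x₁) y₁ (2 * t₀)) nullDomain :=
    fun z hz => hmem z.1 z.2 hz
  have hu' : ContinuousOn (Function.uncurry fun x y => -fluxExchange φ p m (-x) y)
      (triangle (-x₁) y₁ (2 * t₀)) :=
    (H.continuousOn_fluxExchange.comp (by fun_prop) hmaps).neg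
  have key := triangle_divergence (u := fun x y => nullFlux φ p (-x) y)
    (v := fun x y => nullFlux φ m (-x) y) (by linarith)
    (fun x y hxy => by
      simpa [Function.comp_def] using
        (H.hasDerivAt_outFlux (hmem x y hxy)).comp x (hasDerivAt_neg x))
    (fun x y hxy => H.hasDerivAt_inFlux (hmem x y hxy)) hu' hu'
  have i₁ := intervalIntegrable_of_mem_nullDomain H.continuousOn_inFlux (fun x => -x)
    (fun _ => y₁) (a := -x₁) (b := y₁ - 2 * t₀) (by linarith) (by fun_prop) (by fun_prop)
    (by rintro x ⟨h₁, h₂⟩; constructor <;> simp only <;> linarith)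
  have i₂ := intervalIntegrable_of_mem_nullDomain H.continuousOn_inFlux (fun x => -x)
    (fun x => x + 2 * t₀) (a := -x₁) (b := y₁ - 2 * t₀) (by linarith) (by fun_prop) (by fun_prop)
    (by rintro x ⟨h₁, h₂⟩; constructor <;> simp only <;> linarith)
  have i₃ := intervalIntegrable_of_mem_nullDomain H.continuousOn_outFlux (fun _ => - -x₁)
    (fun y => y) (a := -x₁ + 2 * t₀) (b := y₁) (by linarith) (by fun_prop) (by fun_prop)
    (by rintro x ⟨h₁, h₂⟩; constructor <;> simp only <;> linarith)
  have i₄ := intervalIntegrable_of_mem_nullDomain H.continuousOn_outFlux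
    (fun y => -(y - 2 * t₀)) (fun y => y) (a := -x₁ + 2 * t₀) (b := y₁) (by linarith)
    (by fun_prop) (by fun_prop)
    (by rintro x ⟨h₁, h₂⟩; constructor <;> simp only <;> linarith)
  have i₅ := intervalIntegrable_of_mem_nullDomain H.continuousOn_outFlux
    (fun r => t₀ - r) (fun r => t₀ + r) (a := t₀ - x₁) (b := y₁ - t₀) (by linarith)
    (by fun_prop) (by fun_prop)
    (by rintro x ⟨h₁, h₂⟩; constructor <;> simp only <;> linarith)
  have i₆ := intervalIntegrable_of_mem_nullDomain H.continuousOn_inFlux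
    (fun r => t₀ - r) (fun r => t₀ + r) (a := t₀ - x₁) (b := y₁ - t₀) (by linarith)
    (by fun_prop) (by fun_prop)
    (by rintro x ⟨h₁, h₂⟩; constructor <;> simp only <;> linarith)
  simp only [sub_self, intervalIntegral.integral_zero] at key
  rw [intervalIntegral.integral_sub i₁ i₂, intervalIntegral.integral_sub i₃ i₄] at key
  rw [intervalIntegral.integral_add i₅ i₆]
  have e₁ := intervalIntegral.integral_comp_neg (a := -x₁) (b := y₁ - 2 * t₀)
    (fun x => nullFlux φ m x y₁)
  have e₂ := intervalIntegral.integral_comp_sub_right (a := t₀ - x₁) (b := y₁ - t₀)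
    (fun x => nullFlux φ m (-x) (x + 2 * t₀)) t₀
  have e₃ := intervalIntegral.integral_comp_add_right (a := t₀ - x₁) (b := y₁ - t₀)
    (fun y => nullFlux φ p (-(y - 2 * t₀)) y) t₀
  ring_nf at e₁ e₂ e₃ key ⊢
  linarith

/-- Energy identity on the triangle above the point `(x₁, y₀)` and below the slice `t = t₀`. -/
lemma future_triangle (H : NullWave φ p m) {x₀ y₀ t₀ : ℝ} (ht : 0 < x₀ + y₀)
    (hx : t₀ < y₀) (hy : x₀ + y₀ ≤ 2 * t₀) :
    (∫ x in x₀..(2 * t₀ - y₀), nullFlux φ m x y₀)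
      + ∫ y in y₀..(2 * t₀ - x₀), nullFlux φ p x₀ y
      = ∫ r in (y₀ - t₀)..(t₀ - x₀),
          (nullFlux φ p (t₀ - r) (t₀ + r) + nullFlux φ m (t₀ - r) (t₀ + r)) := by
  have hmem : ∀ x y, (x, y) ∈ triangle x₀ (-y₀) (-(2 * t₀)) → (x, -y) ∈ nullDomain := by
    rintro x y ⟨h₁, h₂, h₃⟩
    simp only at h₁ h₂ h₃
    constructor <;> simp only <;> linarith
  have hmaps : MapsTo (fun z : ℝ × ℝ => (z.1, -z.2)) (triangle x₀ (-y₀) (-(2 * t₀)))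
      nullDomain := fun z hz => hmem z.1 z.2 hz
  have hu' : ContinuousOn (Function.uncurry fun x y => fluxExchange φ p m x (-y))
      (triangle x₀ (-y₀) (-(2 * t₀))) :=
    H.continuousOn_fluxExchange.comp (by fun_prop) hmaps
  have key := triangle_divergence (u := fun x y => nullFlux φ p x (-y))
    (v := fun x y => nullFlux φ m x (-y)) (by linarith)
    (fun x y hxy => H.hasDerivAt_outFlux (hmem x y hxy))
    (fun x y hxy => by
      simpa [Function.comp_def] using
        (H.hasDerivAt_inFlux (hmem x y hxy)).comp y (hasDerivAt_neg y)) hu' hu'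
  have i₁ := intervalIntegrable_of_mem_nullDomain H.continuousOn_inFlux (fun x => x)
    (fun _ => - -y₀) (a := x₀) (b := -y₀ - -(2 * t₀)) (by linarith) (by fun_prop) (by fun_prop)
    (by rintro x ⟨h₁, h₂⟩; constructor <;> simp only <;> linarith)
  have i₂ := intervalIntegrable_of_mem_nullDomain H.continuousOn_inFlux (fun x => x)
    (fun x => -(x + -(2 * t₀))) (a := x₀) (b := -y₀ - -(2 * t₀)) (by linarith)
    (by fun_prop) (by fun_prop)
    (by rintro x ⟨h₁, h₂⟩; constructor <;> simp only <;> linarith)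
  have i₃ := intervalIntegrable_of_mem_nullDomain H.continuousOn_outFlux (fun _ => x₀)
    (fun y => -y) (a := x₀ + -(2 * t₀)) (b := -y₀) (by linarith) (by fun_prop) (by fun_prop)
    (by rintro x ⟨h₁, h₂⟩; constructor <;> simp only <;> linarith)
  have i₄ := intervalIntegrable_of_mem_nullDomain H.continuousOn_outFlux
    (fun y => y - -(2 * t₀)) (fun y => -y) (a := x₀ + -(2 * t₀)) (b := -y₀) (by linarith)
    (by fun_prop) (by fun_prop)
    (by rintro x ⟨h₁, h₂⟩; constructor <;> simp only <;> linarith)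
  have i₅ := intervalIntegrable_of_mem_nullDomain H.continuousOn_outFlux
    (fun r => t₀ - r) (fun r => t₀ + r) (a := y₀ - t₀) (b := t₀ - x₀) (by linarith)
    (by fun_prop) (by fun_prop)
    (by rintro x ⟨h₁, h₂⟩; constructor <;> simp only <;> linarith)
  have i₆ := intervalIntegrable_of_mem_nullDomain H.continuousOn_inFlux
    (fun r => t₀ - r) (fun r => t₀ + r) (a := y₀ - t₀) (b := t₀ - x₀) (by linarith)
    (by fun_prop) (by fun_prop)
    (by rintro x ⟨h₁, h₂⟩; constructor <;> simp only <;> linarith)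
  simp only [sub_self, intervalIntegral.integral_zero] at key
  rw [intervalIntegral.integral_sub i₁ i₂, intervalIntegral.integral_sub i₃ i₄] at key
  rw [intervalIntegral.integral_add i₅ i₆]
  have e₁ := intervalIntegral.integral_comp_neg (a := x₀ + -(2 * t₀)) (b := -y₀)
    (fun y => nullFlux φ p x₀ y)
  have e₂ := intervalIntegral.integral_comp_sub_left (a := y₀ - t₀) (b := t₀ - x₀)
    (fun x => nullFlux φ m x (-(x + -(2 * t₀)))) t₀
  have e₃ := intervalIntegral.integral_comp_sub_left (a := y₀ - t₀) (b := t₀ - x₀)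
    (fun y => nullFlux φ p (y - -(2 * t₀)) (-y)) (-t₀)
  ring_nf at e₁ e₂ e₃ key ⊢
  linarith

end NullWave

namespace NullWave

variable {φ p m : ℝ → ℝ → ℝ} {E : ℝ}

/-- The energy on time slices away from the origin is at most `E`. -/
def SliceBound (φ p m : ℝ → ℝ → ℝ) (E : ℝ) : Prop :=
  ∀ t r₁ r₂ : ℝ, 0 < t → 0 < r₁ → r₁ ≤ r₂ →
    ∫ r in r₁..r₂, (nullFlux φ p (t - r) (t + r) + nullFlux φ m (t - r) (t + r)) ≤ E

lemma SliceBound.nonneg (hE : SliceBound φ p m E) : 0 ≤ E := by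
  simpa using hE 1 1 1 one_pos one_pos le_rfl

lemma intervalIntegrable_outFlux (H : NullWave φ p m) {x y₀ y₁ : ℝ} (h : x < y₀)
    (h' : 0 < x + y₀) (hy : y₀ ≤ y₁) :
    IntervalIntegrable (fun y => nullFlux φ p x y) volume y₀ y₁ :=
  intervalIntegrable_of_mem_nullDomain H.continuousOn_outFlux (fun _ => x) (fun y => y) hy
    (by fun_prop) (by fun_prop)
    (by rintro y ⟨h₁, h₂⟩; constructor <;> simp only <;> linarith)

lemma intervalIntegrable_inFlux (H : NullWave φ p m) {x₀ x₁ y : ℝ} (h : x₁ < y)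
    (h' : 0 < x₀ + y) (hx : x₀ ≤ x₁) :
    IntervalIntegrable (fun x => nullFlux φ m x y) volume x₀ x₁ :=
  intervalIntegrable_of_mem_nullDomain H.continuousOn_inFlux (fun x => x) (fun _ => y) hx
    (by fun_prop) (by fun_prop)
    (by rintro x ⟨h₁, h₂⟩; constructor <;> simp only <;> linarith)

lemma integral_outFlux_le (H : NullWave φ p m) (hE : SliceBound φ p m E) {x y₀ y₁ : ℝ}
    (h : x < y₀) (h' : 0 < x + y₀) (hy : y₀ ≤ y₁) : ∫ y in y₀..y₁, nullFlux φ p x y ≤ E := by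
  have key := H.past_triangle (x₁ := x) (y₁ := y₁) (t₀ := (x + y₀) / 2) (by linarith)
    (by linarith) (by linarith)
  have hE' := hE ((x + y₀) / 2) ((x + y₀) / 2 - x) (y₁ - (x + y₀) / 2) (by linarith)
    (by linarith) (by linarith)
  have hpos : 0 ≤ ∫ x in (2 * ((x + y₀) / 2) - y₁)..x, nullFlux φ m x y₁ :=
    intervalIntegral.integral_nonneg (by linarith) fun z hz =>
      nullFlux_nonneg (by linarith [hz.2])
  rw [show 2 * ((x + y₀) / 2) - x = y₀ by ring] at key
  linarith

lemma integral_inFlux_le (H : NullWave φ p m) (hE : SliceBound φ p m E) {x₀ x₁ y : ℝ}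
    (h : x₁ < y) (h' : 0 < x₀ + y) (hx : x₀ ≤ x₁) : ∫ x in x₀..x₁, nullFlux φ m x y ≤ E := by
  have key := H.future_triangle (x₀ := x₀) (y₀ := y) (t₀ := (x₁ + y) / 2) (by linarith)
    (by linarith) (by linarith)
  have hE' := hE ((x₁ + y) / 2) (y - (x₁ + y) / 2) ((x₁ + y) / 2 - x₀) (by linarith)
    (by linarith) (by linarith)
  have hpos : 0 ≤ ∫ z in y..(2 * ((x₁ + y) / 2) - x₀), nullFlux φ p x₀ z :=
    intervalIntegral.integral_nonneg (by linarith) fun z hz =>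
      nullFlux_nonneg (by linarith [hz.1])
  rw [show 2 * ((x₁ + y) / 2) - y = x₁ by ring] at key
  linarith

lemma integrableOn_outFlux (H : NullWave φ p m) (hE : SliceBound φ p m E) {x y₀ : ℝ}
    (h : x < y₀) (h' : 0 < x + y₀) : IntegrableOn (fun y => nullFlux φ p x y) (Ioi y₀) := by
  refine integrableOn_Ioi_of_intervalIntegral_norm_bounded (l := atTop) (b := fun y => max y y₀)
    E y₀ (fun y => ?_) (tendsto_atTop_mono (fun y => le_max_left _ _) tendsto_id)
    (Eventually.of_forall fun y => ?_)
  · rw [← intervalIntegrable_iff_integrableOn_Ioc_of_le (le_max_right _ _)]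
    exact H.intervalIntegrable_outFlux h h' (le_max_right _ _)
  · refine le_of_eq_of_le ?_ (H.integral_outFlux_le hE h h' (le_max_right y y₀))
    refine intervalIntegral.integral_congr fun z hz => ?_
    rw [uIcc_of_le (le_max_right _ _)] at hz
    exact norm_of_nonneg (nullFlux_nonneg (by linarith [hz.1]))

lemma tail_outFlux (H : NullWave φ p m) (hE : SliceBound φ p m E) {x ε : ℝ}
    (hx : 0 ≤ x) (hε : 0 < ε) :
    ∀ᶠ y₀ in atTop, ∀ y₁, y₀ ≤ y₁ → ∫ y in y₀..y₁, nullFlux φ p x y ≤ ε := by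
  have h_int := H.integrableOn_outFlux hE (x := x) (y₀ := x + 1) (by linarith) (by linarith)
  have hlim := intervalIntegral_tendsto_integral_Ioi (x + 1) h_int tendsto_id
  have hev := hlim.eventually (lt_mem_nhds (sub_lt_self _ hε))
  filter_upwards [hev, eventually_ge_atTop (x + 1)] with y₀ h₁ h₂ y₁ h₃
  have hle : ∫ y in (x + 1)..y₁, nullFlux φ p x y
      ≤ ∫ y in Ioi (x + 1), nullFlux φ p x y := by
    rw [intervalIntegral.integral_of_le (h₂.trans h₃)]
    refine setIntegral_mono_set h_int ?_ Ioc_subset_Ioi_self.eventuallyLE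
    exact (ae_restrict_mem measurableSet_Ioi).mono fun y (hy : x + 1 < y) =>
      nullFlux_nonneg (by linarith)
  rw [← intervalIntegral.integral_add_adjacent_intervals
    (H.intervalIntegrable_outFlux (by linarith) (by linarith) h₂)
    (H.intervalIntegrable_outFlux (by linarith) (by linarith) h₃)] at hle
  simp only [id] at h₁
  linarith

lemma mem_nullDomain_of_rectangle {x₀ x₁ y₀ y₁ : ℝ} (h : x₁ < y₀) (h' : 0 < x₀ + y₀) :
    Icc x₀ x₁ ×ˢ Icc y₀ y₁ ⊆ nullDomain := by
  rintro ⟨x, y⟩ ⟨⟨h₁, h₂⟩, h₃, h₄⟩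
  simp only at h₁ h₂ h₃ h₄
  constructor <;> simp only <;> linarith

/-- Energy identity on a null rectangle. -/
lemma rectangle_energy (H : NullWave φ p m) {x₀ x₁ y₀ y₁ : ℝ} (hx : x₀ ≤ x₁) (hy : y₀ ≤ y₁)
    (h : x₁ < y₀) (h' : 0 < x₀ + y₀) :
    (∫ y in y₀..y₁, nullFlux φ p x₁ y) + ∫ x in x₀..x₁, nullFlux φ m x y₁
      = (∫ y in y₀..y₁, nullFlux φ p x₀ y) + ∫ x in x₀..x₁, nullFlux φ m x y₀ := by
  have hD := mem_nullDomain_of_rectangle (y₁ := y₁) h h'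
  have hc := H.continuousOn_fluxExchange.mono hD
  have k₁ := rectangle_divergence_le (u := fun x y => nullFlux φ p x y)
    (v := fun x y => -nullFlux φ m x y) hx hy
    (fun x hx y hy => H.hasDerivAt_outFlux (hD ⟨hx, hy⟩))
    (fun x hx y hy => by simpa using (H.hasDerivAt_inFlux (hD ⟨hx, hy⟩)).fun_neg) hc hc
    (fun x hx y hy => le_rfl)
  have k₂ := rectangle_divergence_le (u := fun x y => -nullFlux φ p x y)
    (v := fun x y => nullFlux φ m x y) hx hy
    (fun x hx y hy => (H.hasDerivAt_outFlux (hD ⟨hx, hy⟩)).fun_neg)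
    (fun x hx y hy => H.hasDerivAt_inFlux (hD ⟨hx, hy⟩)) hc.neg hc.neg
    (fun x hx y hy => le_rfl)
  have i₁ := H.intervalIntegrable_outFlux (x := x₁) (y₀ := y₀) (y₁ := y₁) (by linarith)
    (by linarith) hy
  have i₂ := H.intervalIntegrable_outFlux (x := x₀) (y₀ := y₀) (y₁ := y₁) (by linarith)
    (by linarith) hy
  have i₃ := H.intervalIntegrable_inFlux (x₀ := x₀) (x₁ := x₁) (y := y₁) (by linarith)
    (by linarith) hx
  have i₄ := H.intervalIntegrable_inFlux (x₀ := x₀) (x₁ := x₁) (y := y₀) (by linarith)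
    (by linarith) hx
  simp only [neg_sub_neg] at k₁ k₂
  rw [intervalIntegral.integral_sub i₁ i₂, intervalIntegral.integral_sub i₄ i₃] at k₁
  rw [intervalIntegral.integral_sub i₂ i₁, intervalIntegral.integral_sub i₃ i₄] at k₂
  linarith

/-- The incoming flux has a limit at null infinity. -/
lemma exists_tendsto_inFlux (H : NullWave φ p m) (hE : SliceBound φ p m E) {x : ℝ} (hx : 1 ≤ x) :
    ∃ V, Tendsto (fun y => ∫ z in (1 : ℝ)..x, nullFlux φ m z y) atTop (nhds V) := by
  have h₁ := intervalIntegral_tendsto_integral_Ioi (x + 1)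
    (H.integrableOn_outFlux hE (x := x) (y₀ := x + 1) (by linarith) (by linarith)) tendsto_id
  have h₂ := intervalIntegral_tendsto_integral_Ioi (x + 1)
    (H.integrableOn_outFlux hE (x := 1) (y₀ := x + 1) (by linarith) (by linarith)) tendsto_id
  refine ⟨_, ((h₂.sub h₁).add_const (∫ z in (1 : ℝ)..x, nullFlux φ m z (x + 1))).congr' ?_⟩
  filter_upwards [eventually_ge_atTop (x + 1)] with y hy
  have := H.rectangle_energy (x₀ := 1) (x₁ := x) (y₀ := x + 1) (y₁ := y) hx hy (by linarith)
    (by linarith)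
  simp only [id]
  linarith

/-- Almost all of the energy radiated to null infinity is radiated before a finite retarded
time. -/
lemma eventually_inFlux_le (H : NullWave φ p m) (hE : SliceBound φ p m E) {ε : ℝ} (hε : 0 < ε) :
    ∃ A₀ ≥ 1, ∀ A, A₀ ≤ A → ∀ x, A ≤ x →
      ∀ᶠ y in atTop, ∫ z in A..x, nullFlux φ m z y ≤ ε := by
  choose! V hV using fun x hx => H.exists_tendsto_inFlux hE (x := x) hx
  have hbdd : BddAbove (V '' Ici 1) := by
    refine ⟨E, ?_⟩
    rintro _ ⟨x, hx, rfl⟩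
    refine le_of_tendsto (hV x hx) ?_
    filter_upwards [eventually_gt_atTop x, eventually_gt_atTop 0] with y hy hy'
    exact H.integral_inFlux_le hE hy (by linarith) hx
  obtain ⟨_, ⟨A₀, hA₀, rfl⟩, hlt⟩ := exists_lt_of_lt_csSup (s := V '' Ici 1)
    ⟨_, mem_image_of_mem V (self_mem_Ici (a := (1 : ℝ)))⟩ (sub_lt_self (sSup (V '' Ici 1)) hε)
  have hA₀' : 1 ≤ A₀ := hA₀
  refine ⟨A₀, hA₀, fun A hA x hx => ?_⟩
  have hsplit : ∀ {a b : ℝ}, 1 ≤ a → a ≤ b → ∀ᶠ y in atTop,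
      ∫ z in a..b, nullFlux φ m z y
        = (∫ z in (1 : ℝ)..b, nullFlux φ m z y) - ∫ z in (1 : ℝ)..a, nullFlux φ m z y := by
    intro a b ha hab
    filter_upwards [eventually_gt_atTop b] with y hy
    rw [← intervalIntegral.integral_add_adjacent_intervals
      (H.intervalIntegrable_inFlux (x₀ := 1) (x₁ := a) (y := y) (by linarith) (by linarith) ha)
      (H.intervalIntegrable_inFlux hy (by linarith) hab)]
    ring
  have hmono : V A₀ ≤ V A := by
    refine sub_nonneg.1 (ge_of_tendsto ((hV A (by linarith)).sub (hV A₀ hA₀')) ?_)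
    filter_upwards [hsplit hA₀' hA, eventually_gt_atTop A] with y hy hy'
    rw [← hy]
    exact intervalIntegral.integral_nonneg hA fun z hz => nullFlux_nonneg (by linarith [hz.2])
  have hle : V x ≤ sSup (V '' Ici 1) :=
    le_csSup hbdd (mem_image_of_mem V (show (1 : ℝ) ≤ x by linarith))
  have hlim := (hV x (by linarith)).sub (hV A (by linarith))
  filter_upwards [hlim.eventually (gt_mem_nhds (show V x - V A < ε by linarith)),
    hsplit (a := A) (b := x) (by linarith) hx] with y h₁ h₂
  rw [h₂]
  exact h₁.le

end NullWave

namespace NullWave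

variable {φ p m : ℝ → ℝ → ℝ} {E : ℝ}

lemma fluxExchange_le {x y θ : ℝ} (h : x < y) (hθ : 0 < θ) :
    fluxExchange φ p m x y
      ≤ 3 / (y - x) * (θ * nullFlux φ p x y + nullFlux φ m x y / θ) := by
  have hρ : 0 < y - x := sub_pos.2 h
  unfold fluxExchange nullFlux
  rw [sin_two_mul]
  generalize hρ' : y - x = ρ at *
  generalize p x y = P
  generalize hM : m x y = M
  have hC : cos (φ x y) ^ 2 ≤ 1 := cos_sq_le_one _
  generalize cos (φ x y) = C at *
  generalize sin (φ x y) = S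
  obtain ⟨N, rfl⟩ : ∃ N, M = θ * N := ⟨M / θ, by field_simp⟩
  obtain ⟨T, rfl⟩ : ∃ T, S = ρ * T := ⟨S / ρ, by field_simp⟩
  have hle : -(P * N) * θ / 2 - 2 * (P - θ * N) * (T * C) + 2 * T ^ 2
      ≤ 3 * (θ * (P ^ 2 / 2 + 2 * T ^ 2) + (θ * N ^ 2 / 2 + 2 * T ^ 2 / θ)) := by
    have e₁ : -(P * N) * θ / 2 ≤ θ * (P ^ 2 + N ^ 2) / 4 := by
      nlinarith [mul_nonneg hθ.le (sq_nonneg (P + N))]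
    have e₂ : -(2 * P * (T * C)) ≤ θ * P ^ 2 / 2 + 2 * (T * C) ^ 2 / θ := by
      have : 0 ≤ (θ * P + 2 * (T * C)) ^ 2 / (2 * θ) := by positivity
      have e : (θ * P + 2 * (T * C)) ^ 2 / (2 * θ)
        = θ * P ^ 2 / 2 + 2 * (T * C) ^ 2 / θ + 2 * P * (T * C) := by field_simp; ring
      linarith
    have e₃ : 2 * θ * N * (T * C) ≤ θ * N ^ 2 / 2 + 2 * θ * (T * C) ^ 2 := by
      nlinarith [mul_nonneg hθ.le (sq_nonneg (N - 2 * (T * C)))]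
    have e₄ : (T * C) ^ 2 ≤ T ^ 2 := by
      rw [mul_pow]
      exact mul_le_of_le_one_right (sq_nonneg T) hC
    have e₅ : 2 * (T * C) ^ 2 / θ ≤ 2 * T ^ 2 / θ := by gcongr
    have e₆ : 2 * θ * (T * C) ^ 2 ≤ 2 * θ * T ^ 2 := by gcongr
    have e₇ : 2 * T ^ 2 ≤ θ * T ^ 2 + T ^ 2 / θ := by
      have : 0 ≤ T ^ 2 * (θ - 1) ^ 2 / θ := by positivity
      have e : T ^ 2 * (θ - 1) ^ 2 / θ = θ * T ^ 2 + T ^ 2 / θ - 2 * T ^ 2 := by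
        field_simp; ring
      linarith
    have e₈ : 2 * T ^ 2 / θ = 2 * (T ^ 2 / θ) := by ring
    have : 0 ≤ T ^ 2 / θ := by positivity
    have : 0 ≤ θ * T ^ 2 := by positivity
    have : 0 ≤ θ * P ^ 2 := by positivity
    have : 0 ≤ θ * N ^ 2 := by positivity
    linarith
  calc _ = -(P * N) * θ / 2 - 2 * (P - θ * N) * (T * C) + 2 * T ^ 2 := by
        field_simp
    _ ≤ _ := hle
    _ = _ := by field_simp

/-- Propagation of smallness of the incoming flux from null infinity to a finite advanced time. -/
lemma inFlux_le_of_later (H : NullWave φ p m) {x₀ x₁ y₀ y₁ : ℝ} (hx : x₀ ≤ x₁) (hy : y₀ ≤ y₁)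
    (h : x₁ < y₀) (h' : 0 < x₀ + y₀) :
    ∫ x in x₀..x₁, nullFlux φ m x y₀
      ≤ exp (81 / (y₀ - x₁) * (x₁ - x₀)) * ((∫ y in y₀..y₁, nullFlux φ p x₀ y)
          + 2 * ∫ x in x₀..x₁, nullFlux φ m x y₁) := by
  set d := y₀ - x₁ with hd
  have hdpos : 0 < d := by linarith
  set κ := 81 / d with hκ
  have hκpos : 0 < κ := by positivity
  have hD := mem_nullDomain_of_rectangle (y₁ := y₁) h h'
  set w : ℝ → ℝ := fun x => exp (-(κ * (x - x₀))) with hw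
  set ω : ℝ → ℝ := fun y => 2 - d / (y - x₁) with hω
  have hwd : ∀ x, HasDerivAt w (w x * -κ) x := fun x => by
    have := ((((hasDerivAt_id x).sub_const x₀).const_mul κ).fun_neg).exp
    simpa [hw] using this
  have hωd : ∀ y ∈ Icc y₀ y₁, HasDerivAt ω (d / (y - x₁) ^ 2) y := fun y hy => by
    have hne : y - x₁ ≠ 0 := by linarith [hy.1]
    refine (((hasDerivAt_const y d).div ((hasDerivAt_id y).sub_const x₁) hne).const_sub
      2).congr_deriv ?_
    simp only [id]
    ring
  have hwpos : ∀ x, 0 < w x := fun x => exp_pos _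
  have hwc : Continuous w := by fun_prop
  have hne : ∀ z ∈ Icc x₀ x₁ ×ˢ Icc y₀ y₁, z.2 - x₁ ≠ 0 := fun z hz => by
    linarith [hz.2.1]
  have hne' : ∀ z ∈ Icc x₀ x₁ ×ˢ Icc y₀ y₁, (z.2 - x₁) ^ 2 ≠ 0 :=
    fun z hz => pow_ne_zero 2 (hne z hz)
  have hc := H.continuousOn_fluxExchange.mono hD
  have hca := H.continuousOn_outFlux.mono hD
  have hcb := H.continuousOn_inFlux.mono hD
  have hωc : ContinuousOn (fun z : ℝ × ℝ => ω z.2) (Icc x₀ x₁ ×ˢ Icc y₀ y₁) := by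
    simp only [hω]
    fun_prop (disch := assumption)
  have key := rectangle_divergence_le
    (u := fun x y => w x * nullFlux φ p x y)
    (u' := fun x y => w x * -κ * nullFlux φ p x y + w x * fluxExchange φ p m x y)
    (v := fun x y => w x * (ω y * nullFlux φ m x y))
    (v' := fun x y => w x * (d / (y - x₁) ^ 2 * nullFlux φ m x y
      + ω y * -fluxExchange φ p m x y)) hx hy
    (fun x hx y hy => (hwd x).mul (H.hasDerivAt_outFlux (hD ⟨hx, hy⟩)))
    (fun x hx y hy => ((hωd y hy).mul (H.hasDerivAt_inFlux (hD ⟨hx, hy⟩))).const_mul (w x))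
    (by
      change ContinuousOn (fun z : ℝ × ℝ => w z.1 * -κ * Function.uncurry (nullFlux φ p) z
        + w z.1 * Function.uncurry (fluxExchange φ p m) z) _
      fun_prop)
    (by
      change ContinuousOn (fun z : ℝ × ℝ => w z.1 * (d / (z.2 - x₁) ^ 2 *
        Function.uncurry (nullFlux φ m) z
        + ω z.2 * -Function.uncurry (fluxExchange φ p m) z)) _
      have hdc : ContinuousOn (fun z : ℝ × ℝ => d / (z.2 - x₁) ^ 2) (Icc x₀ x₁ ×ˢ Icc y₀ y₁) :=
        ContinuousOn.div continuousOn_const (by fun_prop) hne'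
      exact (hwc.comp continuous_fst).continuousOn.mul ((hdc.mul hcb).add (hωc.mul hc.neg)))
    (by
      intro x hx y hy
      have hσ : 0 < y - x₁ := by linarith [hy.1]
      have hρ : y - x₁ ≤ y - x := by linarith [hx.2]
      have ha := nullFlux_nonneg (φ := φ) (q := p) (x := x) (y := y) (by linarith)
      have hb := nullFlux_nonneg (φ := φ) (q := m) (x := x) (y := y) (by linarith)
      have hθ : 0 < 9 * (y - x₁) / d := by positivity
      have hL := fluxExchange_le (φ := φ) (p := p) (m := m) (x := x) (y := y) (by linarith) hθ
      have hω1 : 1 ≤ ω y := by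
        have : d / (y - x₁) ≤ 1 := (div_le_one hσ).2 (by linarith [hy.1])
        simp only [hω]; linarith
      have hω2 : ω y ≤ 2 := by
        have : 0 ≤ d / (y - x₁) := by positivity
        simp only [hω]; linarith
      have hB : 0 ≤ 9 * (y - x₁) / d * nullFlux φ p x y
          + nullFlux φ m x y / (9 * (y - x₁) / d) := by positivity
      have h₃ : (1 + ω y) * fluxExchange φ p m x y
          ≤ κ * nullFlux φ p x y + d / (y - x₁) ^ 2 * nullFlux φ m x y := by
        calc _ ≤ (1 + ω y) * (3 / (y - x) * (9 * (y - x₁) / d * nullFlux φ p x y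
              + nullFlux φ m x y / (9 * (y - x₁) / d))) := by gcongr
          _ ≤ 3 * (3 / (y - x₁) * (9 * (y - x₁) / d * nullFlux φ p x y
              + nullFlux φ m x y / (9 * (y - x₁) / d))) := by
            refine mul_le_mul (by linarith) ?_ (mul_nonneg (div_nonneg (by norm_num)
              (by linarith)) hB) (by norm_num)
            gcongr
          _ = _ := by
            rw [hκ]
            field_simp
            ring
      have := mul_le_mul_of_nonneg_left h₃ (hwpos x).le
      linarith)
  have ia := H.intervalIntegrable_outFlux (x := x₁) (y₀ := y₀) (y₁ := y₁) (by linarith)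
    (by linarith) hy
  have ia' := H.intervalIntegrable_outFlux (x := x₀) (y₀ := y₀) (y₁ := y₁) (by linarith)
    (by linarith) hy
  have ib := H.intervalIntegrable_inFlux (x₀ := x₀) (x₁ := x₁) (y := y₁) (by linarith)
    (by linarith) hx
  have ib' := H.intervalIntegrable_inFlux (x₀ := x₀) (x₁ := x₁) (y := y₀) (by linarith)
    (by linarith) hx
  have hw₀ : w x₀ = 1 := by simp [hw]
  have l₁ : -∫ y in y₀..y₁, nullFlux φ p x₀ y
      ≤ ∫ y in y₀..y₁, (w x₁ * nullFlux φ p x₁ y - w x₀ * nullFlux φ p x₀ y) := by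
    rw [← intervalIntegral.integral_neg]
    refine intervalIntegral.integral_mono_on hy ia'.neg ((ia.const_mul _).sub (ia'.const_mul _))
      fun y hy' => ?_
    have := mul_nonneg (hwpos x₁).le (nullFlux_nonneg (φ := φ) (q := p) (x := x₁) (y := y)
      (by linarith [hy'.1]))
    rw [hw₀]
    linarith
  have l₂ : ∫ x in x₀..x₁, (w x * (ω y₁ * nullFlux φ m x y₁) - w x * (ω y₀ * nullFlux φ m x y₀))
      ≤ ∫ x in x₀..x₁, (2 * nullFlux φ m x y₁
          - exp (-(κ * (x₁ - x₀))) * nullFlux φ m x y₀) := by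
    refine intervalIntegral.integral_mono_on hx (((ib.const_mul _).continuousOn_mul
      hwc.continuousOn).sub ((ib'.const_mul _).continuousOn_mul hwc.continuousOn))
      ((ib.const_mul _).sub (ib'.const_mul _)) fun x hx' => ?_
    have hb := nullFlux_nonneg (φ := φ) (q := m) (x := x) (y := y₁) (by linarith [hx'.2])
    have hb' := nullFlux_nonneg (φ := φ) (q := m) (x := x) (y := y₀) (by linarith [hx'.2])
    have hω₀ : ω y₀ = 1 := by
      simp only [hω, ← hd]
      rw [div_self hdpos.ne']
      norm_num
    have hω₁ : ω y₁ ≤ 2 := by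
      have : 0 ≤ d / (y₁ - x₁) := div_nonneg hdpos.le (by linarith)
      simp only [hω]; linarith
    have hw₁ : w x ≤ 1 := exp_le_one_iff.2 (by nlinarith [hx'.1])
    have hw₂ : exp (-(κ * (x₁ - x₀))) ≤ w x := exp_le_exp.2 (by nlinarith [hx'.2])
    have g₁ : w x * (ω y₁ * nullFlux φ m x y₁) ≤ 1 * (2 * nullFlux φ m x y₁) := by
      refine mul_le_mul_of_nonneg hw₁ (by gcongr) (hwpos x).le (by positivity)
    have g₂ : exp (-(κ * (x₁ - x₀))) * nullFlux φ m x y₀ ≤ w x * nullFlux φ m x y₀ := by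
      gcongr
    rw [hω₀]
    linarith
  have l₃ := (l₁.trans key).trans l₂
  rw [intervalIntegral.integral_sub (ib.const_mul _) (ib'.const_mul _),
    intervalIntegral.integral_const_mul, intervalIntegral.integral_const_mul, exp_neg] at l₃
  have l₄ : (exp (κ * (x₁ - x₀)))⁻¹ * ∫ x in x₀..x₁, nullFlux φ m x y₀
      ≤ (∫ y in y₀..y₁, nullFlux φ p x₀ y) + 2 * ∫ x in x₀..x₁, nullFlux φ m x y₁ := by
    linarith
  rwa [inv_mul_le_iff₀ (exp_pos _)] at l₄

lemma momentumFlux_le {q : ℝ → ℝ → ℝ} {x y : ℝ} (h : x < y) :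
    momentumFlux φ q x y ≤ (y - x) / 4 * nullFlux φ q x y := by
  have h' : 0 < y - x := sub_pos.2 h
  have e : (y - x) / 4 * nullFlux φ q x y
      = (y - x) ^ 2 / 8 * q x y ^ 2 + sin (φ x y) ^ 2 / 2 := by
    unfold nullFlux
    field_simp
    ring
  rw [e, momentumFlux]
  linarith [sq_nonneg (sin (φ x y))]

lemma neg_momentumFlux_le {q : ℝ → ℝ → ℝ} {x y : ℝ} :
    -momentumFlux φ q x y ≤ sin (φ x y) ^ 2 / 2 := by
  unfold momentumFlux
  have : 0 ≤ (y - x) ^ 2 / 8 * q x y ^ 2 := by positivity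
  linarith

/-- The kinetic energy density `φ_t² r` in null coordinates. -/
def kinetic (p m : ℝ → ℝ → ℝ) (x y : ℝ) : ℝ := (y - x) / 8 * (p x y + m x y) ^ 2

lemma continuousOn_momentumFlux {q : ℝ → ℝ → ℝ}
    (hφ : ContinuousOn (Function.uncurry φ) nullDomain)
    (hq : ContinuousOn (Function.uncurry q) nullDomain) :
    ContinuousOn (Function.uncurry (momentumFlux φ q)) nullDomain := by
  change ContinuousOn (fun z : ℝ × ℝ => (z.2 - z.1) ^ 2 / 8 * (Function.uncurry q z) ^ 2
    - sin (Function.uncurry φ z) ^ 2 / 2) nullDomain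
  fun_prop

/-- The virial inequality on a triangle. -/
lemma integral_kinetic_le (H : NullWave φ p m) {x₀ y₁ c : ℝ} (hx : 0 ≤ x₀) (hc : 0 < c)
    (h : x₀ + c ≤ y₁) :
    ∫ x in x₀..(y₁ - c), ∫ y in (x + c)..y₁, kinetic p m x y
      ≤ (∫ x in x₀..(y₁ - c), (y₁ - x) / 4 * nullFlux φ m x y₁)
        + (∫ y in (x₀ + c)..y₁, (y - x₀) / 4 * nullFlux φ p x₀ y)
        + ∫ x in x₀..(y₁ - c), sin (φ x (x + c)) ^ 2 := by
  have hD : triangle x₀ y₁ c ⊆ nullDomain := by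
    rintro ⟨x, y⟩ ⟨h₁, h₂, h₃⟩
    simp only at h₁ h₂ h₃
    constructor <;> simp only <;> linarith
  have key := triangle_divergence (u := momentumFlux φ p) (v := momentumFlux φ m) h
    (fun x y hxy => H.hasDerivAt_outMomentum (hD hxy))
    (fun x y hxy => H.hasDerivAt_inMomentum (hD hxy))
    (H.continuousOn_outMomentumDeriv.mono hD) (H.continuousOn_inMomentumDeriv.mono hD)
  have e : ∀ x y, inMomentumDeriv φ p m x y - outMomentumDeriv φ p m x y = kinetic p m x y := by
    intro x y
    unfold inMomentumDeriv outMomentumDeriv kinetic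
    ring
  simp only [e] at key
  rw [key]
  have cα := continuousOn_momentumFlux H.continuousOn H.continuousOn_out
  have cβ := continuousOn_momentumFlux H.continuousOn H.continuousOn_in
  have csin : ContinuousOn (Function.uncurry fun x y => sin (φ x y) ^ 2) nullDomain := by
    have := H.continuousOn
    change ContinuousOn (fun z : ℝ × ℝ => sin (Function.uncurry φ z) ^ 2) nullDomain
    fun_prop
  have i₁ := intervalIntegrable_of_mem_nullDomain cβ (fun x => x) (fun _ => y₁)
    (a := x₀) (b := y₁ - c) (by linarith) (by fun_prop) (by fun_prop)
    (by rintro x ⟨h₁, h₂⟩; constructor <;> simp only <;> linarith)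
  have i₂ := intervalIntegrable_of_mem_nullDomain cβ (fun x => x) (fun x => x + c)
    (a := x₀) (b := y₁ - c) (by linarith) (by fun_prop) (by fun_prop)
    (by rintro x ⟨h₁, h₂⟩; constructor <;> simp only <;> linarith)
  have i₃ := intervalIntegrable_of_mem_nullDomain cα (fun _ => x₀) (fun y => y)
    (a := x₀ + c) (b := y₁) (by linarith) (by fun_prop) (by fun_prop)
    (by rintro x ⟨h₁, h₂⟩; constructor <;> simp only <;> linarith)
  have i₄ := intervalIntegrable_of_mem_nullDomain cα (fun y => y - c) (fun y => y)
    (a := x₀ + c) (b := y₁) (by linarith) (by fun_prop) (by fun_prop)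
    (by rintro x ⟨h₁, h₂⟩; constructor <;> simp only <;> linarith)
  have s₁ := (intervalIntegrable_of_mem_nullDomain csin (fun x => x) (fun x => x + c)
    (a := x₀) (b := y₁ - c) (by linarith) (by fun_prop) (by fun_prop)
    (by rintro x ⟨h₁, h₂⟩; constructor <;> simp only <;> linarith)).div_const 2
  have s₂ := (intervalIntegrable_of_mem_nullDomain csin (fun y => y - c) (fun y => y)
    (a := x₀ + c) (b := y₁) (by linarith) (by fun_prop) (by fun_prop)
    (by rintro x ⟨h₁, h₂⟩; constructor <;> simp only <;> linarith)).div_const 2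
  have f₁ := (H.intervalIntegrable_inFlux (x₀ := x₀) (x₁ := y₁ - c) (y := y₁) (by linarith)
    (by linarith) (by linarith)).continuousOn_mul (g := fun x => (y₁ - x) / 4) (by fun_prop)
  have f₂ := (H.intervalIntegrable_outFlux (x := x₀) (y₀ := x₀ + c) (y₁ := y₁) (by linarith)
    (by linarith) (by linarith)).continuousOn_mul (g := fun y => (y - x₀) / 4) (by fun_prop)
  have l₁ : ∫ x in x₀..(y₁ - c), (momentumFlux φ m x y₁ - momentumFlux φ m x (x + c))
      ≤ (∫ x in x₀..(y₁ - c), (y₁ - x) / 4 * nullFlux φ m x y₁)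
        + ∫ x in x₀..(y₁ - c), sin (φ x (x + c)) ^ 2 / 2 := by
    rw [← intervalIntegral.integral_add f₁ s₁]
    refine intervalIntegral.integral_mono_on (by linarith) (i₁.sub i₂) (f₁.add s₁)
      fun x hx => ?_
    have h₁ := momentumFlux_le (φ := φ) (q := m) (x := x) (y := y₁) (by linarith [hx.2])
    have h₂ := neg_momentumFlux_le (φ := φ) (q := m) (x := x) (y := x + c)
    linarith
  have l₂ : ∫ y in (x₀ + c)..y₁, (momentumFlux φ p x₀ y - momentumFlux φ p (y - c) y)
      ≤ (∫ y in (x₀ + c)..y₁, (y - x₀) / 4 * nullFlux φ p x₀ y)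
        + ∫ y in (x₀ + c)..y₁, sin (φ (y - c) y) ^ 2 / 2 := by
    rw [← intervalIntegral.integral_add f₂ s₂]
    refine intervalIntegral.integral_mono_on (by linarith) (i₃.sub i₄) (f₂.add s₂)
      fun y hy => ?_
    have h₁ := momentumFlux_le (φ := φ) (q := p) (x := x₀) (y := y) (by linarith [hy.1])
    have h₂ := neg_momentumFlux_le (φ := φ) (q := p) (x := y - c) (y := y)
    linarith
  have e₁ := intervalIntegral.integral_comp_add_right (a := x₀) (b := y₁ - c)
    (fun y => sin (φ (y - c) y) ^ 2) c
  rw [sub_add_cancel] at e₁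
  simp only [add_sub_cancel_right] at e₁
  rw [intervalIntegral.integral_div] at l₁ l₂
  rw [← e₁] at l₂
  linarith

end NullWave

namespace NullWave

variable {φ p m : ℝ → ℝ → ℝ} {E : ℝ}

lemma integral_weighted_le {f w : ℝ → ℝ} {a b C : ℝ} (hab : a ≤ b)
    (hf : IntervalIntegrable f volume a b) (hw : Continuous w)
    (hf₀ : ∀ x ∈ Icc a b, 0 ≤ f x) (hwC : ∀ x ∈ Icc a b, w x ≤ C) :
    ∫ x in a..b, w x * f x ≤ C * ∫ x in a..b, f x := by
  rw [← intervalIntegral.integral_const_mul]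
  exact intervalIntegral.integral_mono_on hab (hf.continuousOn_mul hw.continuousOn)
    (hf.const_mul C) fun x hx => mul_le_mul_of_nonneg_right (hwC x hx) (hf₀ x hx)

lemma weighted_inFlux_le (H : NullWave φ p m) (hE : SliceBound φ p m E) {ε : ℝ} (hε : 0 < ε) :
    ∃ A₀ ≥ 1, ∀ A, A₀ ≤ A → ∀ᶠ y₀ in atTop, ∀ c, 0 < c → c < 1 →
      ∫ x in A..(y₀ - c), (y₀ - x) / 4 * nullFlux φ m x y₀ ≤ ε * y₀ := by
  have hE₀ := hE.nonneg
  set μ := min (1 / 2) (ε / (E + 1)) with hμ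
  have hμ₀ : 0 < μ := by positivity
  have hμ₁ : μ ≤ 1 / 2 := min_le_left _ _
  have hμE : μ * E ≤ ε := by
    have : μ * (E + 1) ≤ ε := (le_div_iff₀ (by positivity)).1 (min_le_right _ _)
    linarith
  set ε' := ε / (3 * exp (81 / μ)) with hε'
  have hε'₀ : 0 < ε' := by positivity
  obtain ⟨A₀, hA₀, hin⟩ := H.eventually_inFlux_le hE hε'₀
  refine ⟨A₀, hA₀, fun A hA => ?_⟩
  have hA1 : 1 ≤ A := le_trans hA₀ hA
  filter_upwards [H.tail_outFlux hE (x := A) (by linarith) hε'₀, eventually_ge_atTop (2 * A + 1),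
    eventually_ge_atTop (1 / μ)] with y₀ hout hy₀ hyμ c hc hc₁
  have hμy : 1 ≤ μ * y₀ := by
    rw [div_le_iff₀ hμ₀] at hyμ
    linarith
  have hμy' : μ * y₀ ≤ y₀ / 2 := by nlinarith
  set x₁ := y₀ - μ * y₀ with hx₁
  have hAx : A ≤ x₁ := by linarith
  obtain ⟨y₁, hy₁, hb₁⟩ := ((eventually_ge_atTop y₀).and (hin A hA x₁ hAx)).exists
  have hlater := H.inFlux_le_of_later hAx hy₁ (by linarith) (by linarith)
  have hexp : exp (81 / (y₀ - x₁) * (x₁ - A)) ≤ exp (81 / μ) := by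
    rw [exp_le_exp, hx₁, sub_sub_cancel, div_mul_eq_mul_div, div_le_div_iff₀ (by linarith) hμ₀]
    nlinarith
  have hsmall : ∫ x in A..x₁, nullFlux φ m x y₀ ≤ ε := by
    refine hlater.trans ?_
    calc _ ≤ exp (81 / μ) * (ε' + 2 * ε') := by
          refine mul_le_mul_of_nonneg hexp ?_ (exp_pos _).le (by positivity)
          linarith [hout y₁ hy₁]
      _ = ε := by
          rw [hε']
          field_simp
          norm_num
  have i₁ := H.intervalIntegrable_inFlux (x₀ := A) (x₁ := x₁) (y := y₀) (by linarith)
    (by linarith) hAx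
  have i₂ := H.intervalIntegrable_inFlux (x₀ := x₁) (x₁ := y₀ - c) (y := y₀) (by linarith)
    (by linarith) (by linarith)
  have b₁ := integral_weighted_le (w := fun x => (y₀ - x) / 4) (C := y₀ / 4) hAx i₁
    (by fun_prop) (fun x hx => nullFlux_nonneg (by linarith [hx.2]))
    (fun x hx => by linarith [hx.1])
  have b₂ := integral_weighted_le (w := fun x => (y₀ - x) / 4) (C := μ * y₀ / 4)
    (by linarith) i₂ (by fun_prop) (fun x hx => nullFlux_nonneg (by linarith [hx.2]))
    (fun x hx => by linarith [hx.1])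
  have b₃ := H.integral_inFlux_le hE (x₀ := x₁) (x₁ := y₀ - c) (y := y₀) (by linarith)
    (by linarith) (by linarith)
  rw [← intervalIntegral.integral_add_adjacent_intervals
    (i₁.continuousOn_mul (g := fun x => (y₀ - x) / 4) (by fun_prop))
    (i₂.continuousOn_mul (g := fun x => (y₀ - x) / 4) (by fun_prop))]
  have b₄ : y₀ / 4 * ∫ x in A..x₁, nullFlux φ m x y₀ ≤ y₀ / 4 * ε := by
    gcongr
    linarith
  have b₅ : μ * y₀ / 4 * ∫ x in x₁..(y₀ - c), nullFlux φ m x y₀ ≤ μ * y₀ / 4 * E := by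
    gcongr
  nlinarith

lemma weighted_outFlux_le (H : NullWave φ p m) (hE : SliceBound φ p m E) {A ε : ℝ} (hA : 1 ≤ A)
    (hε : 0 < ε) :
    ∀ᶠ y₀ in atTop, ∀ c, 0 < c → c < 1 →
      ∫ y in (A + c)..y₀, (y - A) / 4 * nullFlux φ p A y ≤ ε * y₀ := by
  have hE₀ := hE.nonneg
  obtain ⟨Y, hY, hYA⟩ := ((H.tail_outFlux hE (x := A) (by linarith) hε).and
    (eventually_ge_atTop (A + 1))).exists
  filter_upwards [eventually_ge_atTop Y, eventually_ge_atTop (Y * E / ε)] with y₀ hy₀ hyE c hc hc₁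
  rw [div_le_iff₀ hε] at hyE
  have i₁ := H.intervalIntegrable_outFlux (x := A) (y₀ := A + c) (y₁ := Y) (by linarith)
    (by linarith) (by linarith)
  have i₂ := H.intervalIntegrable_outFlux (x := A) (y₀ := Y) (y₁ := y₀) (by linarith)
    (by linarith) hy₀
  have b₁ := integral_weighted_le (w := fun y => (y - A) / 4) (C := Y / 4) (by linarith) i₁
    (by fun_prop) (fun x hx => nullFlux_nonneg (by linarith [hx.1]))
    (fun x hx => by linarith [hx.2])
  have b₂ := integral_weighted_le (w := fun y => (y - A) / 4) (C := y₀ / 4) hy₀ i₂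
    (by fun_prop) (fun x hx => nullFlux_nonneg (by linarith [hx.1]))
    (fun x hx => by linarith [hx.2])
  rw [← intervalIntegral.integral_add_adjacent_intervals
    (i₁.continuousOn_mul (g := fun y => (y - A) / 4) (by fun_prop))
    (i₂.continuousOn_mul (g := fun y => (y - A) / 4) (by fun_prop))]
  have b₃ := H.integral_outFlux_le hE (x := A) (y₀ := A + c) (y₁ := Y) (by linarith)
    (by linarith) (by linarith)
  have b₄ : Y / 4 * ∫ y in (A + c)..Y, nullFlux φ p A y ≤ Y / 4 * E := by
    gcongr
    linarith
  have b₅ : y₀ / 4 * ∫ y in Y..y₀, nullFlux φ p A y ≤ y₀ / 4 * ε := by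
    have := hY y₀ hy₀
    gcongr
    linarith
  nlinarith

/-- Up to the contribution of the axis, the kinetic energy in a truncated cone is sublinear. -/
lemma integral_kinetic_le_eps (H : NullWave φ p m) (hE : SliceBound φ p m E) {ε : ℝ}
    (hε : 0 < ε) :
    ∃ A₀ ≥ 1, ∀ A, A₀ ≤ A → ∀ᶠ y₀ in atTop, ∀ c, 0 < c → c < 1 →
      ∫ x in A..(y₀ - c), ∫ y in (x + c)..y₀, kinetic p m x y
        ≤ ε * y₀ + ∫ x in A..(y₀ - c), sin (φ x (x + c)) ^ 2 := by
  obtain ⟨A₀, hA₀, hin⟩ := H.weighted_inFlux_le hE (half_pos hε)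
  refine ⟨A₀, hA₀, fun A hA => ?_⟩
  have hA1 : 1 ≤ A := le_trans hA₀ hA
  filter_upwards [hin A hA, H.weighted_outFlux_le hE hA1 (half_pos hε),
    eventually_ge_atTop (A + 1)] with y₀ h₁ h₂ h₃ c hc hc₁
  have := H.integral_kinetic_le (x₀ := A) (y₁ := y₀) (by linarith) hc (by linarith)
  linarith [h₁ c hc hc₁, h₂ c hc hc₁]

end NullWave

/-- The open region of positive times and radii. -/
def quadrant : Set (ℝ × ℝ) := Ioi (0 : ℝ) ×ˢ Ioi (0 : ℝ)

lemma isOpen_quadrant_s2 : IsOpen quadrant := isOpen_Ioi.prod isOpen_Ioi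

/-- The point with null coordinates `x = t - r` and `y = t + r`. -/
def ofNull (x y : ℝ) : ℝ × ℝ := ((x + y) / 2, (y - x) / 2)

lemma ofNull_mem_quadrant {x y : ℝ} (h : (x, y) ∈ nullDomain) : ofNull x y ∈ quadrant := by
  obtain ⟨h₁, h₂⟩ := h
  simp only at h₁ h₂
  constructor <;> simp only [ofNull, mem_Ioi] <;> linarith

lemma hasDerivAt_ofNull_fst (x y : ℝ) :
    HasDerivAt (fun x => ofNull x y) ((1 / 2 : ℝ) • ((1 : ℝ), (-1 : ℝ))) x := by
  refine HasDerivAt.congr_deriv (HasDerivAt.prodMk (((hasDerivAt_id x).add_const y).div_const 2)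
    (((hasDerivAt_id x).const_sub y).div_const 2)) ?_
  norm_num

lemma hasDerivAt_ofNull_snd (x y : ℝ) :
    HasDerivAt (fun y => ofNull x y) ((1 / 2 : ℝ) • ((1 : ℝ), (1 : ℝ))) y := by
  refine HasDerivAt.congr_deriv (HasDerivAt.prodMk (((hasDerivAt_id y).const_add x).div_const 2)
    (((hasDerivAt_id y).sub_const x).div_const 2)) ?_
  simp

lemma continuous_ofNull : Continuous (Function.uncurry ofNull) := by
  unfold ofNull Function.uncurry
  fun_prop

/-- `ψ_t + ψ_r` in null coordinates. -/
def nullOut (ψ : ℝ → ℝ → ℝ) (x y : ℝ) : ℝ :=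
  Function.uncurry (pT ψ) (ofNull x y) + Function.uncurry (pR ψ) (ofNull x y)

/-- `ψ_t - ψ_r` in null coordinates. -/
def nullIn (ψ : ℝ → ℝ → ℝ) (x y : ℝ) : ℝ :=
  Function.uncurry (pT ψ) (ofNull x y) - Function.uncurry (pR ψ) (ofNull x y)

lemma minSmoothness_two_le : minSmoothness ℝ 2 ≤ ((⊤ : ℕ∞) : WithTop ℕ∞) := by
  simpa using WithTop.coe_le_coe.2 (le_top (a := (2 : ℕ∞)))

namespace IsWaveMap

variable {ψ : ℝ → ℝ → ℝ}

lemma contDiffAt (hwm : IsWaveMap ψ) {z : ℝ × ℝ} (hz : z ∈ quadrant) :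
    ContDiffAt ℝ (⊤ : ℕ∞) (Function.uncurry ψ) z :=
  (hwm.1.mono (prod_mono Ioi_subset_Ici_self subset_rfl)).contDiffAt
    (isOpen_quadrant_s2.mem_nhds hz)

lemma hasFDerivAt (hwm : IsWaveMap ψ) {z : ℝ × ℝ} (hz : z ∈ quadrant) :
    HasFDerivAt (Function.uncurry ψ) (fderiv ℝ (Function.uncurry ψ) z) z :=
  ((hwm.contDiffAt hz).differentiableAt (by simp)).hasFDerivAt

lemma pT_eq (hwm : IsWaveMap ψ) {t r : ℝ} (hz : (t, r) ∈ quadrant) :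
    pT ψ t r = fderiv ℝ (Function.uncurry ψ) (t, r) (1, 0) :=
  ((hwm.hasFDerivAt hz).comp_hasDerivAt (f := fun s => (s, r)) t
    ((hasDerivAt_id t).prodMk (hasDerivAt_const t r))).deriv

lemma pR_eq (hwm : IsWaveMap ψ) {t r : ℝ} (hz : (t, r) ∈ quadrant) :
    pR ψ t r = fderiv ℝ (Function.uncurry ψ) (t, r) (0, 1) :=
  ((hwm.hasFDerivAt hz).comp_hasDerivAt r
    ((hasDerivAt_const r t).prodMk (hasDerivAt_id r))).deriv

lemma fderiv_apply (hwm : IsWaveMap ψ) {z : ℝ × ℝ} (hz : z ∈ quadrant) (a b : ℝ) :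
    fderiv ℝ (Function.uncurry ψ) z (a, b) = a * pT ψ z.1 z.2 + b * pR ψ z.1 z.2 := by
  rw [hwm.pT_eq hz, hwm.pR_eq hz]
  have : ((a, b) : ℝ × ℝ) = a • ((1 : ℝ), (0 : ℝ)) + b • ((0 : ℝ), (1 : ℝ)) := by simp
  rw [this, map_add, map_smul, map_smul]
  rfl

lemma continuousOn_fderiv (hwm : IsWaveMap ψ) :
    ContinuousOn (fderiv ℝ (Function.uncurry ψ)) quadrant := fun z hz =>
  ((hwm.contDiffAt hz).fderiv_right (m := 0) (by simp)).continuousAt.continuousWithinAt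

lemma continuousOn_pT (hwm : IsWaveMap ψ) : ContinuousOn (Function.uncurry (pT ψ)) quadrant :=
  (hwm.continuousOn_fderiv.clm_apply continuousOn_const).congr fun _ hz => hwm.pT_eq hz

lemma continuousOn_pR (hwm : IsWaveMap ψ) : ContinuousOn (Function.uncurry (pR ψ)) quadrant :=
  (hwm.continuousOn_fderiv.clm_apply continuousOn_const).congr fun _ hz => hwm.pR_eq hz

lemma continuousOn (hwm : IsWaveMap ψ) : ContinuousOn (Function.uncurry ψ) quadrant := fun _ hz =>
  (hwm.contDiffAt hz).continuousAt.continuousWithinAt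

lemma hasFDerivAt_fderiv (hwm : IsWaveMap ψ) {z : ℝ × ℝ} (hz : z ∈ quadrant) (v : ℝ × ℝ) :
    HasFDerivAt (fun z => fderiv ℝ (Function.uncurry ψ) z v)
      ((fderiv ℝ (fderiv ℝ (Function.uncurry ψ)) z).flip v) z := by
  have h := (((hwm.contDiffAt hz).fderiv_right (m := 1) (by norm_cast)).differentiableAt
    (by simp)).hasFDerivAt
  simpa using h.clm_apply (hasFDerivAt_const v z)

lemma deriv_pT (hwm : IsWaveMap ψ) {t r : ℝ} (hz : (t, r) ∈ quadrant) :
    deriv (fun s => pT ψ s r) t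
      = fderiv ℝ (fderiv ℝ (Function.uncurry ψ)) (t, r) (1, 0) (1, 0) := by
  have h := (hwm.hasFDerivAt_fderiv hz (1, 0)).comp_hasDerivAt t
    ((hasDerivAt_id t).prodMk (hasDerivAt_const t r))
  refine Eq.trans (EventuallyEq.deriv_eq ?_) h.deriv
  filter_upwards [lt_mem_nhds (mem_Ioi.1 hz.1)] with s hs using hwm.pT_eq ⟨hs, hz.2⟩

lemma deriv_pR (hwm : IsWaveMap ψ) {t r : ℝ} (hz : (t, r) ∈ quadrant) :
    deriv (fun s => pR ψ t s) r
      = fderiv ℝ (fderiv ℝ (Function.uncurry ψ)) (t, r) (0, 1) (0, 1) := by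
  have h := (hwm.hasFDerivAt_fderiv hz (0, 1)).comp_hasDerivAt r
    ((hasDerivAt_const r t).prodMk (hasDerivAt_id r))
  refine Eq.trans (EventuallyEq.deriv_eq ?_) h.deriv
  filter_upwards [lt_mem_nhds (mem_Ioi.1 hz.2)] with s hs using hwm.pR_eq ⟨hz.1, hs⟩

/-- The wave equation, for the mixed second derivative in the two null directions. -/
lemma fderiv_fderiv_null (hwm : IsWaveMap ψ) {z : ℝ × ℝ} (hz : z ∈ quadrant) :
    fderiv ℝ (fderiv ℝ (Function.uncurry ψ)) z (1, -1) (1, 1)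
      = 1 / z.2 * pR ψ z.1 z.2 - sin (2 * ψ z.1 z.2) / (2 * z.2 ^ 2) := by
  have hsymm := (hwm.contDiffAt hz).isSymmSndFDerivAt minSmoothness_two_le (1, 0) (0, 1)
  have hwave := hwm.2 z.1 z.2 (le_of_lt hz.1) hz.2
  rw [hwm.deriv_pT hz, hwm.deriv_pR hz] at hwave
  have e₁ : ((1, -1) : ℝ × ℝ) = (1, 0) - (0, 1) := by simp
  have e₂ : ((1, 1) : ℝ × ℝ) = (1, 0) + (0, 1) := by simp
  rw [e₁, e₂]
  simp only [map_sub, map_add, sub_apply]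
  simp only [Prod.mk.eta] at hwave
  linarith

lemma nullWave (hwm : IsWaveMap ψ) :
    NullWave (fun x y => Function.uncurry ψ (ofNull x y)) (nullOut ψ) (nullIn ψ) where
  continuousOn := hwm.continuousOn.comp continuous_ofNull.continuousOn
    fun _ hz => ofNull_mem_quadrant hz
  continuousOn_out := (hwm.continuousOn_pT.comp continuous_ofNull.continuousOn
    fun _ hz => ofNull_mem_quadrant hz).add (hwm.continuousOn_pR.comp
      continuous_ofNull.continuousOn fun _ hz => ofNull_mem_quadrant hz)
  continuousOn_in := (hwm.continuousOn_pT.comp continuous_ofNull.continuousOn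
    fun _ hz => ofNull_mem_quadrant hz).sub (hwm.continuousOn_pR.comp
      continuous_ofNull.continuousOn fun _ hz => ofNull_mem_quadrant hz)
  hasDerivAt_fst x y h := by
    have hz := ofNull_mem_quadrant h
    refine ((hwm.hasFDerivAt hz).comp_hasDerivAt x (hasDerivAt_ofNull_fst x y)).congr_deriv ?_
    rw [map_smul, hwm.fderiv_apply hz, smul_eq_mul]
    simp only [nullIn, Function.uncurry]
    ring
  hasDerivAt_snd x y h := by
    have hz := ofNull_mem_quadrant h
    refine ((hwm.hasFDerivAt hz).comp_hasDerivAt y (hasDerivAt_ofNull_snd x y)).congr_deriv ?_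
    rw [map_smul, hwm.fderiv_apply hz, smul_eq_mul]
    simp only [nullOut, Function.uncurry]
    ring
  hasDerivAt_out x y h := by
    have hz := ofNull_mem_quadrant h
    have hd := (hwm.hasFDerivAt_fderiv hz (1, 1)).comp_hasDerivAt x (hasDerivAt_ofNull_fst x y)
    refine (hd.congr_of_eventuallyEq ?_).congr_deriv ?_
    · filter_upwards [(hasDerivAt_ofNull_fst x y).continuousAt.eventually_mem
        (isOpen_quadrant_s2.mem_nhds hz)] with x' hx'
      simp [hwm.fderiv_apply hx', nullOut, Function.uncurry]
    · rw [ContinuousLinearMap.flip_apply, map_smul, smul_apply,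
        hwm.fderiv_fderiv_null hz, smul_eq_mul]
      have hne : y - x ≠ 0 := (sub_pos.2 h.2).ne'
      simp only [nullOut, nullIn, Function.uncurry, ofNull]
      field_simp
      ring
  hasDerivAt_in x y h := by
    have hz := ofNull_mem_quadrant h
    have hd := (hwm.hasFDerivAt_fderiv hz (1, -1)).comp_hasDerivAt y
      (hasDerivAt_ofNull_snd x y)
    refine (hd.congr_of_eventuallyEq ?_).congr_deriv ?_
    · filter_upwards [(hasDerivAt_ofNull_snd x y).continuousAt.eventually_mem
        (isOpen_quadrant_s2.mem_nhds hz)] with x' hx'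
      simp [hwm.fderiv_apply hx', nullIn, Function.uncurry, sub_eq_add_neg]
    · rw [ContinuousLinearMap.flip_apply, map_smul, smul_apply,
        (hwm.contDiffAt hz).isSymmSndFDerivAt minSmoothness_two_le (1, 1) (1, -1),
        hwm.fderiv_fderiv_null hz, smul_eq_mul]
      have hne : y - x ≠ 0 := (sub_pos.2 h.2).ne'
      simp only [nullOut, nullIn, Function.uncurry, ofNull]
      field_simp
      ring

end IsWaveMap

lemma eDen_nonneg {ψ : ℝ → ℝ → ℝ} {t r : ℝ} (hr : 0 < r) : 0 ≤ eDen ψ t r := by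
  unfold eDen
  positivity

lemma ofNull_slice (t r : ℝ) : ofNull (t - r) (t + r) = (t, r) := by
  simp only [ofNull, Prod.mk.injEq]
  constructor <;> ring

lemma integral_eDen_le {ψ : ℝ → ℝ → ℝ} (hfe : FiniteEnergy ψ) (hec : EnergyConserved ψ)
    {t r₁ r₂ : ℝ} (ht : 0 ≤ t) (hr₁ : 0 ≤ r₁) (hr : r₁ ≤ r₂) :
    ∫ r in r₁..r₂, eDen ψ t r ≤ totE ψ 0 := by
  rw [← hec t ht, totE, intervalIntegral.integral_of_le hr]
  refine setIntegral_mono_set (hfe t ht) ?_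
    (Eventually.of_forall fun r h => hr₁.trans_lt h.1)
  exact (ae_restrict_iff' measurableSet_Ioi).2 (Eventually.of_forall fun r h => eDen_nonneg h)

lemma sliceBound {ψ : ℝ → ℝ → ℝ} (hfe : FiniteEnergy ψ) (hec : EnergyConserved ψ) :
    NullWave.SliceBound (fun x y => Function.uncurry ψ (ofNull x y)) (nullOut ψ) (nullIn ψ)
      (2 * totE ψ 0) := by
  intro t r₁ r₂ ht hr₁ hr
  rw [intervalIntegral.integral_congr (g := fun r => 2 * eDen ψ t r),
    intervalIntegral.integral_const_mul]
  · linarith [integral_eDen_le hfe hec ht.le hr₁.le hr]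
  · intro r hr'
    rw [uIcc_of_le hr] at hr'
    have : r ≠ 0 := (hr₁.trans_le hr'.1).ne'
    have e : t + r - (t - r) = 2 * r := by ring
    simp only [nullFlux, nullOut, nullIn, e, ofNull_slice, Function.uncurry, eDen]
    field_simp
    ring

namespace IsWaveMap

variable {ψ : ℝ → ℝ → ℝ}

lemma kinetic_ofNull (ψ : ℝ → ℝ → ℝ) (x t : ℝ) :
    NullWave.kinetic (nullOut ψ) (nullIn ψ) x (2 * t - x) = pT ψ t (t - x) ^ 2 * (t - x) := by
  have e : ofNull x (2 * t - x) = (t, t - x) := by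
    simp only [ofNull, Prod.mk.injEq]
    constructor <;> ring
  simp only [NullWave.kinetic, nullOut, nullIn, e, Function.uncurry]
  ring

lemma continuousOn_kineticDensity (hwm : IsWaveMap ψ) :
    ContinuousOn (Function.uncurry fun t r => pT ψ t r ^ 2 * r) quadrant := by
  have := hwm.continuousOn_pT
  change ContinuousOn (fun z : ℝ × ℝ => Function.uncurry (pT ψ) z ^ 2 * z.2) quadrant
  fun_prop

lemma continuousOn_kinetic (hwm : IsWaveMap ψ) :
    ContinuousOn (Function.uncurry (NullWave.kinetic (nullOut ψ) (nullIn ψ))) nullDomain := by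
  have h₁ := hwm.nullWave.continuousOn_out
  have h₂ := hwm.nullWave.continuousOn_in
  change ContinuousOn (fun z : ℝ × ℝ => (z.2 - z.1) / 8 * (Function.uncurry (nullOut ψ) z
    + Function.uncurry (nullIn ψ) z) ^ 2) nullDomain
  fun_prop

lemma triangle_subset_nullDomain {x₀ y₁ c : ℝ} (hx : 0 ≤ x₀) (hc : 0 < c) :
    triangle x₀ y₁ c ⊆ nullDomain := by
  rintro ⟨x, y⟩ ⟨h₁, h₂, h₃⟩
  simp only at h₁ h₂ h₃
  constructor <;> simp only <;> linarith

lemma kinetic_nonneg {p m : ℝ → ℝ → ℝ} {x y : ℝ} (h : x ≤ y) : 0 ≤ NullWave.kinetic p m x y := by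
  have := sub_nonneg.2 h
  unfold NullWave.kinetic
  positivity

/-- The kinetic energy in a truncated cone, in terms of null coordinates. -/
lemma integral_kineticDensity_le (hwm : IsWaveMap ψ) {A T δ : ℝ} (hA : 0 < A) (hδ : 0 < δ)
    (hT : A + δ ≤ T) :
    ∫ t in (A + δ)..T, ∫ r in δ..(t - A), pT ψ t r ^ 2 * r
      ≤ (∫ x in A..(2 * T - A - 2 * δ), ∫ y in (x + 2 * δ)..(2 * T - A),
          NullWave.kinetic (nullOut ψ) (nullIn ψ) x y) / 2 := by
  have hc : ContinuousOn (Function.uncurry fun x t => pT ψ t (t - x) ^ 2 * (t - x))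
      (triangle A T δ) := by
    refine hwm.continuousOn_kineticDensity.comp (f := fun z : ℝ × ℝ => (z.2, z.2 - z.1))
      (by fun_prop) ?_
    rintro ⟨x, t⟩ ⟨h₁, h₂, h₃⟩
    simp only at h₁ h₂ h₃
    constructor <;> simp only [mem_Ioi] <;> linarith
  have hkc := hwm.continuousOn_kinetic
  have e₁ : ∀ t, ∫ r in δ..(t - A), pT ψ t r ^ 2 * r
      = ∫ x in A..(t - δ), pT ψ t (t - x) ^ 2 * (t - x) := fun t => by
    rw [intervalIntegral.integral_comp_sub_left (fun r => pT ψ t r ^ 2 * r) t, sub_sub_cancel]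
  have e₂ : ∀ x, ∫ t in (x + δ)..T, pT ψ t (t - x) ^ 2 * (t - x)
      = (∫ y in (x + 2 * δ)..(2 * T - x), NullWave.kinetic (nullOut ψ) (nullIn ψ) x y) / 2 :=
    fun x => by
    simp_rw [← kinetic_ofNull]
    rw [intervalIntegral.integral_comp_mul_sub _ two_ne_zero, smul_eq_mul]
    ring_nf
  simp_rw [e₁]
  rw [← integral_triangle_swap hT hc, ← intervalIntegral.integral_div]
  have i₁ := intervalIntegrable_triangle hT hc
  have i₂ := (intervalIntegrable_triangle (x₀ := A) (y₁ := 2 * T - A) (c := 2 * δ) (by linarith)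
    (hkc.mono (triangle_subset_nullDomain hA.le (by linarith)))).div_const 2
  have hnn : ∀ x ∈ Icc A (2 * T - A - 2 * δ), 0 ≤ (∫ y in (x + 2 * δ)..(2 * T - A),
      NullWave.kinetic (nullOut ψ) (nullIn ψ) x y) / 2 := fun x hx =>
    div_nonneg (intervalIntegral.integral_nonneg (by linarith [hx.2])
      fun y hy => kinetic_nonneg (by linarith [hy.1])) zero_le_two
  refine (intervalIntegral.integral_mono_on (by linarith) i₁ (i₂.mono_set ?_)
    fun x hx => ?_).trans (intervalIntegral.integral_mono_interval le_rfl (by linarith)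
      (by linarith) ?_ i₂)
  · rw [uIcc_of_le (by linarith), uIcc_of_le (by linarith)]
    exact Icc_subset_Icc_right (by linarith)
  · rw [e₂]
    gcongr
    refine intervalIntegral.integral_mono_interval le_rfl (by linarith [hx.2])
      (by linarith [hx.1]) ?_ ?_
    · exact (ae_restrict_iff' measurableSet_Ioc).2 (Eventually.of_forall
        fun y hy => kinetic_nonneg (by linarith [hy.1]))
    · exact intervalIntegrable_of_mem_nullDomain hkc (fun _ => x) (fun y => y)
        (by linarith [hx.2]) (by fun_prop) (by fun_prop)
        (by rintro y ⟨h₁, h₂⟩; constructor <;> simp only <;> linarith [hx.1])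
  · exact (ae_restrict_iff' measurableSet_Ioc).2 (Eventually.of_forall
      fun y hy => hnn y ⟨hy.1.le, hy.2⟩)

/-- Along a sequence of radii tending to zero, `sin ψ` tends to zero in `L²` of a time interval. -/
lemma exists_integral_sin_le (hwm : IsWaveMap ψ) (hfe : FiniteEnergy ψ)
    (hec : EnergyConserved ψ) {A B ε d : ℝ} (hA : 0 < A) (hAB : A ≤ B) (hε : 0 < ε)
    (hd : 0 < d) : ∃ δ, 0 < δ ∧ δ < d ∧ ∫ t in A..B, sin (ψ t δ) ^ 2 ≤ ε := by
  by_contra! hcon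
  set b := d / 2 with hb
  have hbpos : 0 < b := by positivity
  have hE : 0 ≤ totE ψ 0 := by simpa using integral_eDen_le hfe hec le_rfl le_rfl (le_refl (0 : ℝ))
  set L := ((B - A) * totE ψ 0 + 1) / ε with hL
  have hLpos : 0 < L := by
    have := mul_nonneg (sub_nonneg.2 hAB) hE
    positivity
  set ρ := b * exp (-L) with hρ
  have hρpos : 0 < ρ := by positivity
  have hρb : ρ ≤ b := mul_le_of_le_one_right hbpos.le (exp_le_one_iff.2 (by linarith))
  have hcont : ContinuousOn (Function.uncurry fun r t => sin (ψ t r) ^ 2 / r)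
      (Icc ρ b ×ˢ Icc A B) := by
    have hψ : ContinuousOn (fun z : ℝ × ℝ => ψ z.2 z.1) (Icc ρ b ×ˢ Icc A B) :=
      hwm.continuousOn.comp (f := Prod.swap) continuous_swap.continuousOn
        fun z hz => ⟨hA.trans_le hz.2.1, hρpos.trans_le hz.1.1⟩
    have hne : ∀ z ∈ Icc ρ b ×ˢ Icc A B, z.1 ≠ 0 := fun z hz => (hρpos.trans_le hz.1.1).ne'
    exact ((continuous_sin.comp_continuousOn hψ).pow 2).div continuousOn_fst hne
  have hswap := integral_rectangle_swap hρb hAB hcont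
  have hupper : ∫ t in A..B, ∫ r in ρ..b, sin (ψ t r) ^ 2 / r ≤ (B - A) * totE ψ 0 := by
    have h_int : IntervalIntegrable (fun t => ∫ r in ρ..b, sin (ψ t r) ^ 2 / r) volume A B := by
      rw [intervalIntegrable_iff_integrableOn_Icc_of_le hAB]
      have := (integrable_rectangle hcont).integral_prod_right
      simpa only [intervalIntegral.integral_of_le hρb, integral_Icc_eq_integral_Ioc,
        IntegrableOn, Function.uncurry] using this
    refine (intervalIntegral.integral_mono_on hAB h_int
      (intervalIntegrable_const (c := totE ψ 0))
      fun t ht => ?_).trans_eq (by simp)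
    refine le_trans ?_ (integral_eDen_le hfe hec (hA.le.trans ht.1) hρpos.le hρb)
    refine intervalIntegral.integral_mono_on hρb ?_ ?_ fun r hr => ?_
    · exact (continuousOn_section_fst hcont hρb fun r hr => ⟨hr, ht⟩).intervalIntegrable
    · rw [intervalIntegrable_iff_integrableOn_Ioc_of_le hρb]
      exact (hfe t (hA.le.trans ht.1)).mono_set fun r hr => hρpos.trans hr.1
    · have hr0 : 0 < r := hρpos.trans_le hr.1
      have e : eDen ψ t r = (pT ψ t r ^ 2 + pR ψ t r ^ 2) * r + sin (ψ t r) ^ 2 / r := by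
        unfold eDen
        field_simp
      rw [e]
      have : 0 ≤ (pT ψ t r ^ 2 + pR ψ t r ^ 2) * r := by positivity
      linarith
  have hlower : ∫ r in ρ..b, ε * r⁻¹ ≤ ∫ r in ρ..b, ∫ t in A..B, sin (ψ t r) ^ 2 / r := by
    refine intervalIntegral.integral_mono_on hρb ?_ ?_ fun r hr => ?_
    · refine ContinuousOn.intervalIntegrable (continuousOn_const.mul
        (continuousOn_id.inv₀ fun r hr => ?_))
      rw [uIcc_of_le hρb] at hr
      exact (hρpos.trans_le hr.1).ne'
    · rw [intervalIntegrable_iff_integrableOn_Icc_of_le hρb]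
      have := (integrable_rectangle hcont).integral_prod_left
      simpa only [intervalIntegral.integral_of_le hAB, integral_Icc_eq_integral_Ioc,
        IntegrableOn, Function.uncurry] using this
    · have hr0 : 0 < r := hρpos.trans_le hr.1
      rw [intervalIntegral.integral_div, div_eq_mul_inv]
      gcongr
      exact (hcon r hr0 (by linarith [hr.2])).le
  rw [intervalIntegral.integral_const_mul, integral_inv_of_pos hρpos hbpos, hswap] at hlower
  have hlog : log (b / ρ) = L := by
    rw [hρ, div_mul_cancel_left₀ hbpos.ne', ← exp_neg, neg_neg, log_exp]
  rw [hlog, hL, mul_div_cancel₀ _ hε.ne'] at hlower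
  linarith

end IsWaveMap

namespace IsWaveMap

variable {ψ : ℝ → ℝ → ℝ}

lemma kineticDensity_le_eDen {t r : ℝ} (hr : 0 < r) : pT ψ t r ^ 2 * r ≤ eDen ψ t r := by
  unfold eDen
  gcongr
  have : 0 ≤ pR ψ t r ^ 2 := sq_nonneg _
  have : 0 ≤ sin (ψ t r) ^ 2 / r ^ 2 := by positivity
  linarith

lemma integrableOn_kineticDensity (hwm : IsWaveMap ψ) (hfe : FiniteEnergy ψ) {t : ℝ}
    (ht : 0 < t) : IntegrableOn (fun r => pT ψ t r ^ 2 * r) (Ioi 0) := by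
  refine (hfe t ht.le).mono' ?_ ?_
  · refine ContinuousOn.aestronglyMeasurable ?_ measurableSet_Ioi
    exact hwm.continuousOn_kineticDensity.comp (f := fun r => (t, r)) (by fun_prop)
      fun r hr => ⟨ht, hr⟩
  · refine (ae_restrict_iff' measurableSet_Ioi).2 (Eventually.of_forall fun r hr => ?_)
    have hr0 : 0 < r := hr
    rw [norm_of_nonneg (by positivity)]
    exact kineticDensity_le_eDen hr0

/-- The kinetic energy in a cone is bounded by its truncations away from the axis. -/
lemma integral_cone_le_of_truncations (hwm : IsWaveMap ψ) (hfe : FiniteEnergy ψ)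
    (hec : EnergyConserved ψ) {A T C : ℝ} (hA : 0 < A) {δ : ℕ → ℝ} (hδ : ∀ n, 0 < δ n)
    (hδT : ∀ n, A + δ n ≤ T) (hlim : Tendsto δ atTop (nhds 0))
    (hC : ∀ n, ∫ t in (A + δ n)..T, ∫ r in (δ n)..(t - A), pT ψ t r ^ 2 * r ≤ C) :
    ∫ t in Ioc A T, ∫ r in Ioc 0 (t - A), pT ψ t r ^ 2 * r ≤ C := by
  set J : ℕ → ℝ → ℝ := fun n => (Icc (A + δ n) T).indicator
    fun t => ∫ r in (δ n)..(t - A), pT ψ t r ^ 2 * r with hJ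
  have hmeas : ∀ n, AEStronglyMeasurable (J n) (volume.restrict (Ioc A T)) := fun n => by
    have hc : ContinuousOn (Function.uncurry fun r t => pT ψ t r ^ 2 * r)
        (triangle (δ n) T A) := by
      refine hwm.continuousOn_kineticDensity.comp (f := Prod.swap)
        continuous_swap.continuousOn ?_
      rintro ⟨r, t⟩ ⟨h₁, h₂, h₃⟩
      simp only at h₁ h₂ h₃
      have := hδ n
      constructor <;> simp only [mem_Ioi, Prod.swap] <;> linarith
    have := (integrable_triangle hc).integral_prod_right
    simp_rw [integral_triangle_fst, add_comm (δ n) A] at this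
    exact this.aestronglyMeasurable.restrict
  have h_int : ∀ n, ∫ t in Ioc A T, J n t
      = ∫ t in (A + δ n)..T, ∫ r in (δ n)..(t - A), pT ψ t r ^ 2 * r := fun n => by
    rw [hJ, setIntegral_indicator measurableSet_Icc, intervalIntegral.integral_of_le (hδT n),
      ← integral_Icc_eq_integral_Ioc, inter_eq_right.2]
    exact fun t ht => ⟨by linarith [ht.1, hδ n], ht.2⟩
  have hkin : ∀ t, 0 < t → IntegrableOn (fun r => pT ψ t r ^ 2 * r) (Ioi 0) :=
    fun t ht => hwm.integrableOn_kineticDensity hfe ht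
  have hbound : ∀ n, ∀ᵐ t ∂volume.restrict (Ioc A T), ‖J n t‖ ≤ totE ψ 0 := fun n => by
    refine (ae_restrict_iff' measurableSet_Ioc).2 (Eventually.of_forall fun t ht => ?_)
    have ht0 : 0 < t := hA.trans ht.1
    by_cases hmem : t ∈ Icc (A + δ n) T
    · have hle : δ n ≤ t - A := by linarith [hmem.1]
      simp only [hJ, indicator_of_mem hmem]
      rw [norm_of_nonneg (intervalIntegral.integral_nonneg hle fun r hr =>
        mul_nonneg (sq_nonneg _) ((hδ n).le.trans hr.1))]
      refine (intervalIntegral.integral_mono_on hle ?_ ?_ fun r hr =>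
        kineticDensity_le_eDen ((hδ n).trans_le hr.1)).trans
        (integral_eDen_le hfe hec ht0.le (hδ n).le hle)
      · rw [intervalIntegrable_iff_integrableOn_Ioc_of_le hle]
        exact (hkin t ht0).mono_set fun r hr => (hδ n).trans hr.1
      · rw [intervalIntegrable_iff_integrableOn_Ioc_of_le hle]
        exact (hfe t ht0.le).mono_set fun r hr => (hδ n).trans hr.1
    · simp only [hJ, indicator_of_notMem hmem, norm_zero]
      simpa using integral_eDen_le hfe hec le_rfl le_rfl (le_refl (0 : ℝ))
  have hpt : ∀ᵐ t ∂volume.restrict (Ioc A T), Tendsto (fun n => J n t) atTop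
      (nhds (∫ r in Ioc 0 (t - A), pT ψ t r ^ 2 * r)) := by
    refine (ae_restrict_iff' measurableSet_Ioc).2 (Eventually.of_forall fun t ht => ?_)
    have htA : 0 < t - A := sub_pos.2 ht.1
    have hcont := intervalIntegral.continuousOn_primitive_interval_left (a := 0) (b := t - A)
      (μ := volume) (f := fun r => pT ψ t r ^ 2 * r) (by
        rw [uIcc_of_le htA.le, integrableOn_Icc_iff_integrableOn_Ioc]
        exact (hkin t (hA.trans ht.1)).mono_set Ioc_subset_Ioi_self)
    rw [← intervalIntegral.integral_of_le htA.le]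
    have hev : ∀ᶠ n in atTop, δ n < t - A := hlim.eventually (gt_mem_nhds htA)
    have hl : Tendsto δ atTop (nhdsWithin 0 (uIcc 0 (t - A))) := by
      refine tendsto_nhdsWithin_iff.2 ⟨hlim, ?_⟩
      filter_upwards [hev] with n hn
      rw [uIcc_of_le htA.le]
      exact ⟨(hδ n).le, hn.le⟩
    refine ((hcont 0 left_mem_uIcc).tendsto.comp hl).congr' ?_
    filter_upwards [hev] with n hn
    have hmem : t ∈ Icc (A + δ n) T := ⟨by linarith, ht.2⟩
    simp only [hJ, indicator_of_mem hmem, Function.comp_def]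
  refine le_of_tendsto' (tendsto_integral_of_dominated_convergence (fun _ => totE ψ 0) hmeas
    (integrableOn_const (by simp)) hbound hpt) fun n => ?_
  rw [h_int]
  exact hC n

lemma integral_cone_le (hwm : IsWaveMap ψ) (hfe : FiniteEnergy ψ) (hec : EnergyConserved ψ)
    {ε : ℝ} (hε : 0 < ε) :
    ∃ A₀ ≥ 1, ∀ A, A₀ ≤ A → ∀ᶠ T in atTop,
      ∫ t in Ioc A T, ∫ r in Ioc 0 (t - A), pT ψ t r ^ 2 * r ≤ ε * T := by
  obtain ⟨A₀, hA₀, hkin⟩ := hwm.nullWave.integral_kinetic_le_eps (sliceBound hfe hec)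
    (half_pos hε)
  refine ⟨A₀, hA₀, fun A hA => ?_⟩
  have hA1 : 1 ≤ A := le_trans hA₀ hA
  have hlim : Tendsto (fun T : ℝ => 2 * T - A) atTop atTop :=
    tendsto_atTop_add_const_right _ _ (tendsto_id.const_mul_atTop two_pos)
  filter_upwards [hlim.eventually (hkin A hA), eventually_ge_atTop (A + 1)] with T hT hAT
  have hεT : 0 < ε * T := mul_pos hε (by linarith)
  choose δ hδ₀ hδ₁ hδ using fun n : ℕ => hwm.exists_integral_sin_le hfe hec
    (A := A) (B := 2 * T - A) (d := 1 / ((n : ℝ) + 1) / 2) (by linarith) (by linarith) hεT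
    (by positivity)
  have hδ₂ : ∀ n, δ n < 1 / ((n : ℝ) + 1) := fun n =>
    (hδ₁ n).trans (half_lt_self (by positivity))
  have hδ₃ : ∀ n, 2 * δ n < 1 := fun n => by
    have : 1 / ((n : ℝ) + 1) ≤ 1 := (div_le_one (by positivity)).2
      (by linarith [n.cast_nonneg (α := ℝ)])
    linarith [hδ₁ n]
  refine hwm.integral_cone_le_of_truncations hfe hec (by linarith) hδ₀
    (fun n => by linarith [hδ₃ n, hδ₀ n])
    (squeeze_zero (fun n => (hδ₀ n).le) (fun n => (hδ₂ n).le)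
      tendsto_one_div_add_atTop_nhds_zero_nat) fun n => ?_
  have h₁ := hwm.integral_kineticDensity_le (A := A) (T := T) (by linarith) (hδ₀ n)
    (by linarith [hδ₃ n, hδ₀ n])
  have h₂ := hT (2 * δ n) (by linarith [hδ₀ n]) (hδ₃ n)
  have h₃ : ∫ x in A..(2 * T - A - 2 * δ n),
      sin (Function.uncurry ψ (ofNull x (x + 2 * δ n))) ^ 2 ≤ ε * T := by
    have e : ∀ x, ofNull x (x + 2 * δ n) = (x + δ n, δ n) := fun x => by
      simp only [ofNull, Prod.mk.injEq]
      constructor <;> ring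
    simp_rw [e, Function.uncurry]
    rw [intervalIntegral.integral_comp_add_right (fun t => sin (ψ t (δ n)) ^ 2)]
    refine (intervalIntegral.integral_mono_interval (by linarith [hδ₀ n]) (by linarith [hδ₃ n])
      (by linarith [hδ₀ n]) (Eventually.of_forall fun _ => sq_nonneg _) ?_).trans (hδ n)
    have hψ : ContinuousOn (fun t => ψ t (δ n)) (uIcc A (2 * T - A)) := by
      refine hwm.continuousOn.comp (f := fun t => (t, δ n)) (by fun_prop) fun t ht => ?_
      rw [uIcc_of_le (by linarith)] at ht
      exact ⟨show 0 < t by linarith [ht.1], hδ₀ n⟩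
    exact ((continuous_sin.comp_continuousOn hψ).pow 2).intervalIntegrable
  nlinarith

end IsWaveMap

/-- vanishing of time averages of the kinetic energy inside the truncated cone. -/
theorem stmt2_time_average_kinetic_decay
    (ψ : ℝ → ℝ → ℝ)
    (hwm : IsWaveMap ψ) (hfe : FiniteEnergy ψ) (hcons : EnergyConserved ψ) :
    ∀ ε > 0, ∃ A₀ > 0, ∀ A : ℝ, A₀ ≤ A →
      Filter.limsup
        (fun T : ℝ => (1 / T) *
          ∫ t in Set.Ioc A T, ∫ r in Set.Ioc 0 (t - A), (pT ψ t r) ^ 2 * r)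
        Filter.atTop ≤ ε := by
  intro ε hε
  obtain ⟨A₀, hA₀, h⟩ := hwm.integral_cone_le hfe hcons hε
  refine ⟨A₀, by linarith, fun A hA => Filter.limsup_le_of_le ?_ ?_⟩
  · refine isCoboundedUnder_le_of_eventually_le (x := 0) _ ?_
    filter_upwards [eventually_ge_atTop 0] with T hT
    exact mul_nonneg (one_div_nonneg.2 hT) (integral_nonneg fun t =>
      setIntegral_nonneg measurableSet_Ioc fun r hr => mul_nonneg (sq_nonneg _) hr.1.le)
  · filter_upwards [h A hA, eventually_gt_atTop 0] with T h₁ h₂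
    rwa [one_div_mul_eq_div, div_le_iff₀ h₂]
end
end
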